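/- arXiv:0711.3221 — 7 statements merged into one kernel-verified Lean document; each statement's English description precedes it below -/
import Mathlib

section
/- Let σ : ℝ → ℍ be an isometry of ℝ into ℍ (a unit-speed geodesic line) with image G = σ(ℝ), and let γ : [0,1] → ℍ be a constant-speed geodesic parametrization from z to w. Then the function t ↦ infDist(γ(t), G) (infimum of hyperbolic distances from γ(t) to points of G) is convex on [0,1]. -/
open UpperHalfPlane Set

lemma aux_cosh (z w : ℍ) : Real.cosh (dist z w) =
    ((z.re - w.re) ^ 2 + z.im ^ 2 + w.im ^ 2) / (2 * z.im * w.im) := by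
  rw [UpperHalfPlane.cosh_dist']

lemma aux_mid_exists (p q : ℍ) : ∃ m : ℍ, ∀ x : ℍ,
    Real.cosh (dist m x) * (2 * Real.cosh (dist p q / 2)) =
      Real.cosh (dist p x) + Real.cosh (dist q x) := by
  have hC : 0 < Real.cosh (dist p q / 2) := Real.cosh_pos _
  have hC2 : Real.cosh (dist p q) = 2 * Real.cosh (dist p q / 2) ^ 2 - 1 := by
    have := Real.cosh_sq (dist p q / 2)
    have h2 := Real.cosh_two_mul (dist p q / 2)
    rw [show 2 * (dist p q / 2) = dist p q by ring] at h2
    linarith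
  rw [aux_cosh] at hC2
  set C := Real.cosh (dist p q / 2)
  have hp := p.im_pos
  have hq := q.im_pos
  refine ⟨⟨⟨(p.re * q.im + q.re * p.im) / (p.im + q.im), 2 * C * p.im * q.im / (p.im + q.im)⟩,
    by show 0 < 2 * C * p.im * q.im / (p.im + q.im); positivity⟩, fun x => ?_⟩
  have hx := x.im_pos
  simp only [aux_cosh]
  change (((p.re * q.im + q.re * p.im) / (p.im + q.im) - x.re) ^ 2 +
    (2 * C * p.im * q.im / (p.im + q.im)) ^ 2 + x.im ^ 2) /
    (2 * (2 * C * p.im * q.im / (p.im + q.im)) * x.im) * (2 * C) = _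
  generalize p.im = b at *
  generalize q.im = d at *
  generalize x.im = y at *
  generalize p.re = a at *
  generalize q.re = c at *
  generalize x.re = u at *
  have hC3 : 4 * C ^ 2 * b * d = (a - c) ^ 2 + (b + d) ^ 2 := by
    field_simp at hC2
    linarith
  have h2 : (2 * C * b * d / (b + d)) ^ 2 = ((a - c) ^ 2 + (b + d) ^ 2) * (b * d) / (b + d) ^ 2 := by
    rw [← hC3]; field_simp; ring
  rw [h2]
  field_simp
  ring

lemma aux_cosh_inj {a b : ℝ} (ha : 0 ≤ a) (hb : 0 ≤ b) (h : Real.cosh a = Real.cosh b) : a = b := by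
  have h1 := Real.cosh_le_cosh.1 h.le
  have h2 := Real.cosh_le_cosh.1 h.ge
  rw [abs_of_nonneg ha, abs_of_nonneg hb] at h1 h2
  exact le_antisymm h1 h2

lemma aux_cosh_half (a : ℝ) : Real.cosh a = 2 * Real.cosh (a / 2) ^ 2 - 1 := by
  have := Real.cosh_sq (a / 2)
  have h2 := Real.cosh_two_mul (a / 2)
  rw [show 2 * (a / 2) = a by ring] at h2
  linarith

lemma aux_mid_exists' (p q : ℍ) : ∃ m : ℍ, dist p m = dist p q / 2 ∧ dist q m = dist p q / 2 := by
  obtain ⟨m, hm⟩ := aux_mid_exists p q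
  have hC : 0 < Real.cosh (dist p q / 2) := Real.cosh_pos _
  have h := aux_cosh_half (dist p q)
  refine ⟨m, ?_, ?_⟩
  · apply aux_cosh_inj dist_nonneg (by positivity)
    have := hm p
    rw [dist_self, dist_comm q p, Real.cosh_zero, h, dist_comm m] at this
    apply mul_right_cancel₀ hC.ne'
    linarith
  · apply aux_cosh_inj dist_nonneg (by positivity)
    have := hm q
    rw [dist_self, Real.cosh_zero, h, dist_comm m] at this
    apply mul_right_cancel₀ hC.ne'
    linarith

lemma aux_median (p q m : ℍ) (h1 : dist p m = dist p q / 2) (h2 : dist q m = dist p q / 2) (x : ℍ) :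
    Real.cosh (dist m x) * (2 * Real.cosh (dist p q / 2)) =
      Real.cosh (dist p x) + Real.cosh (dist q x) := by
  obtain ⟨m', hm⟩ := aux_mid_exists p q
  have hC : 0 < Real.cosh (dist p q / 2) := Real.cosh_pos _
  have := hm m
  rw [h1, h2] at this
  have h3 : Real.cosh (dist m' m) = Real.cosh 0 := by
    rw [Real.cosh_zero]
    apply mul_right_cancel₀ hC.ne'
    linarith
  have h4 := aux_cosh_inj dist_nonneg le_rfl h3
  rw [dist_eq_zero] at h4
  rw [← h4]; exact hm x

lemma aux_triangle (p q r m n : ℍ) (h1 : dist p m = dist p q / 2) (h2 : dist q m = dist p q / 2)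
    (h3 : dist p n = dist p r / 2) (h4 : dist r n = dist p r / 2) :
    dist m n ≤ dist q r / 2 := by
  have e1 := aux_median p q m h1 h2 n
  have e2 := aux_median p r n h3 h4 q
  rw [h3, dist_comm q n] at e1
  rw [aux_cosh_half (dist p q), dist_comm r q, aux_cosh_half (dist q r)] at e2
  have t1 := dist_triangle q p r
  have t2 := dist_triangle p q r
  have t3 := dist_triangle p r q
  rw [dist_comm q p] at t1
  rw [dist_comm r q] at t3
  have hq : 0 ≤ dist q r := dist_nonneg
  have hb : 0 ≤ dist p r := dist_nonneg
  have hc : 0 ≤ dist p q := dist_nonneg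
  have k1 : Real.cosh (dist q r / 2) ≤ Real.cosh (dist p r / 2 + dist p q / 2) := by
    rw [Real.cosh_le_cosh, abs_of_nonneg (by positivity), abs_of_nonneg (by positivity)]
    linarith
  have k2 : Real.cosh (dist p r / 2 - dist p q / 2) ≤ Real.cosh (dist q r / 2) := by
    rw [Real.cosh_le_cosh, abs_of_nonneg (show 0 ≤ dist q r / 2 by positivity), abs_le]
    constructor <;> linarith
  rw [Real.cosh_add] at k1
  rw [Real.cosh_sub] at k2
  have s1 := Real.sinh_sq (dist p r / 2)
  have s2 := Real.sinh_sq (dist p q / 2)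
  have hB := Real.cosh_pos (dist p r / 2)
  have hC := Real.cosh_pos (dist p q / 2)
  suffices h : Real.cosh (dist m n) ≤ Real.cosh (dist q r / 2) by
    rwa [Real.cosh_le_cosh, abs_of_nonneg dist_nonneg, abs_of_nonneg (by positivity)] at h
  generalize Real.cosh (dist p r / 2) = B at *
  generalize Real.cosh (dist p q / 2) = C at *
  generalize Real.sinh (dist p r / 2) = S at *
  generalize Real.sinh (dist p q / 2) = T at *
  generalize Real.cosh (dist q r / 2) = x at *
  generalize Real.cosh (dist m n) = D at *
  generalize Real.cosh (dist n q) = E at *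
  have key : x ^ 2 - 2 * B * C * x + B ^ 2 + C ^ 2 - 1 ≤ 0 := by
    have := mul_nonneg (sub_nonneg.2 k1) (sub_nonneg.2 k2)
    have e : S ^ 2 * T ^ 2 = (B ^ 2 - 1) * (C ^ 2 - 1) := by rw [s1, s2]
    nlinarith
  have e3 : D * (4 * B * C) = 2 * B ^ 2 + 2 * C ^ 2 + 2 * x ^ 2 - 2 := by
    linear_combination 2 * B * e1 + e2
  have : D * (4 * B * C) ≤ x * (4 * B * C) := by linarith
  exact le_of_mul_le_mul_right this (by positivity)

lemma aux_quad (a b c d m n : ℍ) (h1 : dist a m = dist a b / 2) (h2 : dist b m = dist a b / 2)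
    (h3 : dist c n = dist c d / 2) (h4 : dist d n = dist c d / 2) :
    dist m n ≤ (dist a c + dist b d) / 2 := by
  obtain ⟨k, k1, k2⟩ := aux_mid_exists' a d
  have t1 := aux_triangle a b d m k h1 h2 k1 k2
  have t2 := aux_triangle d a c k n (by rw [k2, dist_comm a d]) (by rw [k1, dist_comm a d])
    (by rw [h4, dist_comm c d]) (by rw [h3, dist_comm c d])
  have := dist_triangle m k n
  linarith

lemma aux_midconv (g : ℝ → ℝ) (hg : ContinuousOn g (Icc 0 1)) (h0 : g 0 ≤ 0) (h1 : g 1 ≤ 0)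
    (hm : ∀ s ∈ Icc (0:ℝ) 1, ∀ t ∈ Icc (0:ℝ) 1, g ((s + t) / 2) ≤ (g s + g t) / 2) :
    ∀ t ∈ Icc (0:ℝ) 1, g t ≤ 0 := by
  obtain ⟨c, hc, hmax⟩ := isCompact_Icc.exists_isMaxOn (nonempty_Icc.2 zero_le_one) hg
  by_contra! hcon
  obtain ⟨t, ht, htpos⟩ := hcon
  have hcpos : 0 < g c := htpos.trans_le (hmax ht)
  have hcl : IsCompact (Icc (0:ℝ) 1 ∩ g ⁻¹' {g c}) :=
    isCompact_Icc.of_isClosed_subset (hg.preimage_isClosed_of_isClosed isClosed_Icc isClosed_singleton)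
      inter_subset_left
  obtain ⟨e, ⟨he, hge⟩, hmin⟩ := hcl.exists_isLeast ⟨c, hc, rfl⟩
  have hge : g e = g c := hge
  have e0 : 0 < e := he.1.lt_of_ne (by rintro rfl; linarith)
  have e1 : e < 1 := he.2.lt_of_ne (by rintro rfl; linarith)
  obtain ⟨δ, hδ, hδ0, hδ1⟩ : ∃ δ, 0 < δ ∧ δ ≤ e ∧ δ ≤ 1 - e :=
    ⟨min e (1 - e), lt_min e0 (by linarith), min_le_left _ _, min_le_right _ _⟩
  have m1 : e - δ ∈ Icc (0:ℝ) 1 := ⟨by linarith, by linarith⟩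
  have m2 : e + δ ∈ Icc (0:ℝ) 1 := ⟨by linarith, by linarith⟩
  have := hm _ m1 _ m2
  rw [show (e - δ + (e + δ)) / 2 = e by ring] at this
  have a1 : g (e - δ) ≤ g c := hmax m1
  have a2 : g (e + δ) ≤ g c := hmax m2
  have a3 : e ≤ e - δ := hmin ⟨m1, show g (e - δ) = g c by linarith⟩
  linarith

/-- Convexity of the distance to a geodesic line along a geodesic segment
in the hyperbolic plane (upper half-plane model). -/
theorem infDist_to_geodesic_convexOn
    (σ : ℝ → ℍ) (hσ : Isometry σ)
    (z w : ℍ) (γ : ℝ → ℍ)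
    (hγ0 : γ 0 = z) (hγ1 : γ 1 = w)
    (hγ : ∀ s ∈ Icc (0:ℝ) 1, ∀ t ∈ Icc (0:ℝ) 1,
      dist (γ s) (γ t) = |s - t| * dist z w) :
    ConvexOn ℝ (Icc (0:ℝ) 1) (fun t => Metric.infDist (γ t) (Set.range σ)) := by
  have hne : (Set.range σ).Nonempty := Set.range_nonempty σ
  have hcont : ContinuousOn γ (Icc 0 1) := by
    apply LipschitzOnWith.continuousOn (K := ⟨dist z w, dist_nonneg⟩)
    apply LipschitzOnWith.of_dist_le_mul
    intro s hs t ht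
    rw [hγ s hs t ht, Real.dist_eq, mul_comm]
    rfl
  have hF : ContinuousOn (fun t => Metric.infDist (γ t) (Set.range σ)) (Icc 0 1) :=
    (Metric.continuous_infDist_pt _).comp_continuousOn hcont
  have hmid : ∀ s ∈ Icc (0:ℝ) 1, ∀ t ∈ Icc (0:ℝ) 1,
      Metric.infDist (γ ((s + t) / 2)) (Set.range σ) ≤
        (Metric.infDist (γ s) (Set.range σ) + Metric.infDist (γ t) (Set.range σ)) / 2 := by
    intro s hs t ht
    apply le_of_forall_pos_le_add
    intro ε hε
    obtain ⟨_, ⟨u, rfl⟩, hu⟩ := (Metric.infDist_lt_iff hne).1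
      (lt_add_of_pos_right (Metric.infDist (γ s) (Set.range σ)) hε)
    obtain ⟨_, ⟨v, rfl⟩, hv⟩ := (Metric.infDist_lt_iff hne).1
      (lt_add_of_pos_right (Metric.infDist (γ t) (Set.range σ)) hε)
    have hst : (s + t) / 2 ∈ Icc (0:ℝ) 1 :=
      ⟨by linarith [hs.1, ht.1], by linarith [hs.2, ht.2]⟩
    have ab1 (x y : ℝ) : |x - (x + y) / 2| = |x - y| / 2 := by
      rw [show x - (x + y) / 2 = (x - y) / 2 by ring, abs_div, abs_two]
    have ab2 (x y : ℝ) : |y - (x + y) / 2| = |x - y| / 2 := by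
      rw [show y - (x + y) / 2 = (y - x) / 2 by ring, abs_div, abs_two, abs_sub_comm]
    have := aux_quad (γ s) (γ t) (σ u) (σ v) (γ ((s + t) / 2)) (σ ((u + v) / 2))
      (by rw [hγ s hs _ hst, hγ s hs t ht, ab1]; ring)
      (by rw [hγ t ht _ hst, hγ s hs t ht, ab2]; ring)
      (by rw [hσ.dist_eq, hσ.dist_eq, Real.dist_eq, Real.dist_eq, ab1])
      (by rw [hσ.dist_eq, hσ.dist_eq, Real.dist_eq, Real.dist_eq, ab2])
    have h2 := Metric.infDist_le_dist_of_mem (x := γ ((s + t) / 2))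
      (Set.mem_range_self (f := σ) ((u + v) / 2))
    linarith
  refine ⟨convex_Icc 0 1, ?_⟩
  set F : ℝ → ℝ := fun t => Metric.infDist (γ t) (Set.range σ) with hFdef
  have hmid' : ∀ s ∈ Icc (0:ℝ) 1, ∀ t ∈ Icc (0:ℝ) 1, F ((s + t) / 2) ≤ (F s + F t) / 2 := hmid
  clear_value F
  intro x hx y hy a b ha hb hab
  have hmem : ∀ t ∈ Icc (0:ℝ) 1, (1 - t) * x + t * y ∈ Icc (0:ℝ) 1 := fun t ht =>
    convex_Icc (0:ℝ) 1 hx hy (sub_nonneg.2 ht.2) ht.1 (by ring)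
  have key := aux_midconv (fun t => F ((1 - t) * x + t * y) - ((1 - t) * F x + t * F y))
    ((hF.comp (by fun_prop) hmem).sub (by fun_prop)) (by simp) (by simp)
    (fun s hs t ht => by
      have := hmid' _ (hmem s hs) _ (hmem t ht)
      rw [show ((1 - s) * x + s * y + ((1 - t) * x + t * y)) / 2 =
        (1 - (s + t) / 2) * x + (s + t) / 2 * y by ring] at this
      linarith) b ⟨hb, by linarith⟩
  have ha' : 1 - b = a := by linarith
  simp only [ha'] at key
  simp only [smul_eq_mul]
  linarith
end

section
/- Fix p₁, p₂ ∈ ℍ. For each n ∈ ℕ let Lₙ = dist(p₁, p₂ + n) and let γₙ : [0, Lₙ] → ℍ be the unit-speed geodesic segment with γₙ(0) = p₁ and γₙ(Lₙ) = p₂ + n, i.e. dist(γₙ(s), γₙ(t)) = |s−t| for s,t ∈ [0, Lₙ]. Then for every fixed t ≥ 0, the horizontally translated terminal points γₙ(Lₙ − t) − n converge in ℂ to the point Re(p₂) + i·Im(p₂)·e^t as n → ∞. -/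
open UpperHalfPlane Set Filter

/-- Upper half-plane counterpart of Proposition 2.2 for terminal tangents: after
translating back by `-n`, the geodesics from `p₁` to the horizontal translates
`p₂ + n` converge, near their terminal point, to the upward vertical geodesic
through `p₂`. -/
theorem geodesic_to_translates_terminal_segment_tendsto_vertical
    (p₁ p₂ : ℍ) (L : ℕ → ℝ) (hL : ∀ n, L n = dist p₁ ((n : ℝ) +ᵥ p₂))
    (γ : ℕ → ℝ → ℍ)
    (hγ0 : ∀ n, γ n 0 = p₁) (hγ1 : ∀ n, γ n (L n) = (n : ℝ) +ᵥ p₂)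
    (hγ : ∀ n, ∀ s ∈ Icc (0:ℝ) (L n), ∀ t ∈ Icc (0:ℝ) (L n),
      dist (γ n s) (γ n t) = |s - t|) :
    ∀ t : ℝ, 0 ≤ t →
      Tendsto (fun n => (γ n (L n - t) : ℂ) - (n : ℂ)) atTop
        (nhds ((p₂.re : ℂ) + (p₂.im : ℂ) * Real.exp t * Complex.I)) := by
  intro t ht
  set a := p₂.re with ha
  set b := p₂.im with hb
  set c := p₁.re with hc
  set d := p₁.im with hd
  have hbpos : 0 < b := p₂.im_pos
  have hdpos : 0 < d := p₁.im_pos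
  have hL0 : ∀ n, 0 ≤ L n := fun n => by rw [hL]; exact dist_nonneg
  have key : ∀ z w : ℍ, (z.re - w.re) ^ 2 + z.im ^ 2 + w.im ^ 2
      = 2 * z.im * w.im * Real.cosh (dist z w) := by
    intro z w
    have h1 := z.im_pos
    have h2 := w.im_pos
    rw [UpperHalfPlane.cosh_dist']
    field_simp
  have hLc : ∀ n : ℕ, (c - (n + a)) ^ 2 + d ^ 2 + b ^ 2 = 2 * d * b * Real.cosh (L n) := by
    intro n
    have := key p₁ ((n : ℝ) +ᵥ p₂)
    rw [← hL n] at this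
    simpa using this
  -- inverse powers
  have hn : Tendsto (fun n : ℕ => (n : ℝ)⁻¹) atTop (nhds 0) :=
    tendsto_inv_atTop_nhds_zero_nat
  have bdd : ∀ (f : ℕ → ℝ) (K : ℝ), (∀ᶠ n in atTop, |f n| ≤ K) →
      Tendsto (fun n : ℕ => f n * (n : ℝ)⁻¹) atTop (nhds 0) := by
    intro f K h
    have h0 : Tendsto (fun n : ℕ => K * (n : ℝ)⁻¹) atTop (nhds 0) := by
      simpa using hn.const_mul K
    refine squeeze_zero_norm' ?_ h0
    filter_upwards [h] with n h
    rw [norm_mul, Real.norm_eq_abs, Real.norm_eq_abs, abs_of_nonneg (by positivity : 0 ≤ (n:ℝ)⁻¹)]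
    gcongr
  have hpos : ∀ᶠ n : ℕ in atTop, (0:ℝ) < n := by
    filter_upwards [eventually_gt_atTop 0] with n hn
    exact_mod_cast hn
  have hC : Tendsto (fun n : ℕ => Real.cosh (L n) * (n : ℝ)⁻¹ ^ 2) atTop
      (nhds (1 / (2 * d * b))) := by
    have h1 : Tendsto (fun n : ℕ => (((c - a) * (n:ℝ)⁻¹ - 1) ^ 2 + (d ^ 2 + b ^ 2) * (n:ℝ)⁻¹ ^ 2)
        / (2 * d * b)) atTop (nhds ((((c - a) * 0 - 1) ^ 2 + (d ^ 2 + b ^ 2) * 0 ^ 2)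
        / (2 * d * b))) :=
      ((((hn.const_mul _).sub_const 1).pow 2).add ((hn.pow 2).const_mul _)).div_const _
    have h2 : (((c - a) * 0 - 1) ^ 2 + (d ^ 2 + b ^ 2) * 0 ^ 2) / (2 * d * b)
        = 1 / (2 * d * b) := by ring
    rw [h2] at h1
    refine h1.congr' ?_
    filter_upwards [hpos] with n hn
    have := hLc n
    field_simp
    linear_combination this
  have hLt : ∀ᶠ n in atTop, t ≤ L n := by
    have h0 : Tendsto (fun n : ℕ => Real.cosh t * (n : ℝ)⁻¹ ^ 2) atTop (nhds 0) := by
      simpa using (hn.pow 2).const_mul (Real.cosh t)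
    have hp : 0 < 1 / (2 * d * b) := by positivity
    filter_upwards [h0.eventually_lt hC hp] with n h
    have h3 : Real.cosh t < Real.cosh (L n) := lt_of_mul_lt_mul_right h (by positivity)
    rw [Real.cosh_lt_cosh, abs_of_nonneg ht, abs_of_nonneg (hL0 n)] at h3
    exact h3.le
  have hD : Tendsto (fun n : ℕ => Real.cosh (L n - t) * (n : ℝ)⁻¹ ^ 2) atTop
      (nhds (Real.exp (-t) / (2 * d * b))) := by
    have h1 := bdd (fun n => Real.exp (-L n)) 1 (Eventually.of_forall fun n => by
      rw [abs_of_pos (Real.exp_pos _)]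
      exact Real.exp_le_one_iff.2 (by linarith [hL0 n]))
    have h2 := (hC.mul_const (Real.exp (-t))).add ((h1.mul hn).mul_const (Real.sinh t))
    have h3 : 1 / (2 * d * b) * Real.exp (-t) + 0 * 0 * Real.sinh t
      = Real.exp (-t) / (2 * d * b) := by ring
    rw [h3] at h2
    refine h2.congr fun n => ?_
    rw [Real.cosh_sub, ← Real.cosh_sub_sinh t, ← Real.cosh_sub_sinh (L n)]
    ring
  set x : ℕ → ℝ := fun n => (γ n (L n - t)).re - n with hx
  set y : ℕ → ℝ := fun n => (γ n (L n - t)).im with hy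
  have e1 : ∀ᶠ n in atTop, (x n - a) ^ 2 + y n ^ 2 + b ^ 2 = 2 * y n * b * Real.cosh t := by
    filter_upwards [hLt] with n h
    have := key (γ n (L n - t)) ((n : ℝ) +ᵥ p₂)
    rw [← hγ1 n, hγ n _ ⟨by linarith, by linarith⟩ _ ⟨hL0 n, le_rfl⟩, hγ1 n] at this
    simp only [UpperHalfPlane.vadd_re, UpperHalfPlane.vadd_im] at this
    rw [show |L n - t - L n| = t by rw [sub_sub_cancel_left, abs_neg, abs_of_nonneg ht]] at this
    simp only [hx, hy]
    linear_combination this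
  have e2 : ∀ᶠ n : ℕ in atTop, (x n + n - c) ^ 2 + y n ^ 2 + d ^ 2
      = 2 * y n * d * Real.cosh (L n - t) := by
    filter_upwards [hLt] with n h
    have := key (γ n (L n - t)) p₁
    rw [← hγ0 n, hγ n _ ⟨by linarith, by linarith⟩ _ ⟨le_rfl, hL0 n⟩, hγ0 n, sub_zero,
      Real.cosh_abs] at this
    simp only [hx, hy]
    linear_combination this
  have ypos : ∀ n, 0 < y n := fun n => (γ n (L n - t)).im_pos
  have hybd : ∀ᶠ n in atTop, |y n| ≤ 2 * b * Real.cosh t := by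
    filter_upwards [e1] with n h
    rw [abs_of_pos (ypos n)]
    have := ypos n
    refine le_of_mul_le_mul_left ?_ this
    nlinarith [sq_nonneg (x n - a), sq_nonneg b]
  have bx : ∀ᶠ n in atTop, |x n - a| ≤ 2 * b * Real.cosh t := by
    filter_upwards [e1, hybd] with n h h'
    have := ypos n
    rw [abs_of_pos this] at h'
    have hK : 0 < 2 * b * Real.cosh t := by have := Real.cosh_pos t; positivity
    refine abs_le_of_sq_le_sq ?_ hK.le
    nlinarith [sq_nonneg (y n), sq_nonneg b]
  have ty : Tendsto y atTop (nhds (b * Real.exp t)) := by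
    have hxn := bdd _ _ bx
    have hyn := bdd _ _ hybd
    have h1 := ((((hxn.add_const 1).add (hn.const_mul (a - c))).pow 2).add (hyn.pow 2)).add
      ((hn.pow 2).const_mul (d ^ 2))
    have h2 := h1.div (hD.const_mul (2 * d)) (by positivity)
    have h3 : (((0 + 1 + (a - c) * 0) ^ 2 + 0 ^ 2 + d ^ 2 * 0 ^ 2)
        / (2 * d * (Real.exp (-t) / (2 * d * b)))) = b * Real.exp t := by
      rw [Real.exp_neg]
      have := Real.exp_pos t
      field_simp
      ring
    rw [h3] at h2
    refine h2.congr' ?_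
    filter_upwards [hpos, e2] with n hn e
    have := Real.cosh_pos (L n - t)
    simp only [Pi.div_apply]
    rw [div_eq_iff (by positivity)]
    field_simp
    linear_combination e
  have tx : Tendsto (fun n => x n - a) atTop (nhds 0) := by
    have h1 : Tendsto (fun n => 2 * y n * b * Real.cosh t - y n ^ 2 - b ^ 2) atTop
        (nhds (2 * (b * Real.exp t) * b * Real.cosh t - (b * Real.exp t) ^ 2 - b ^ 2)) :=
      (((((ty.const_mul 2).mul_const b).mul_const _).sub (ty.pow 2)).sub_const _)
    have h2 : 2 * (b * Real.exp t) * b * Real.cosh t - (b * Real.exp t) ^ 2 - b ^ 2 = 0 := by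
      rw [Real.cosh_eq, Real.exp_neg]
      have := Real.exp_pos t
      field_simp
      ring
    rw [h2] at h1
    have h3 : Tendsto (fun n => (x n - a) ^ 2) atTop (nhds 0) := by
      refine h1.congr' ?_
      filter_upwards [e1] with n e
      linear_combination -e
    have h4 := (Real.continuous_sqrt.tendsto 0).comp h3
    rw [Real.sqrt_zero] at h4
    rw [tendsto_zero_iff_abs_tendsto_zero]
    refine h4.congr fun n => ?_
    simp [Real.sqrt_sq_eq_abs]
  have tx' : Tendsto x atTop (nhds a) := by simpa using tx.add_const a
  have hx2 := (Complex.continuous_ofReal.tendsto a).comp tx'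
  have hy2 := ((Complex.continuous_ofReal.tendsto _).comp ty).mul_const Complex.I
  have h := hx2.add hy2
  rw [Complex.ofReal_mul] at h
  refine h.congr fun n => ?_
  apply Complex.ext <;> simp [hx, hy]
end

section
/- For all z, w ∈ ℍ and every ε > 0 there exist rational numbers a ≠ b, a unit-speed geodesic line γ : ℝ → ℍ whose endpoints on the real axis are a and b (that is, γ(t) → a in ℂ as t → −∞ and γ(t) → b in ℂ as t → +∞), and parameters s ≤ t with dist(γ(s), z) < ε and dist(γ(t), w) < ε. -/
open UpperHalfPlane Set Filter

/-- The geodesic with endpoints `a`, `b` (parametrised by arclength). -/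
noncomputable def geoC (a b t : ℝ) : ℂ :=
  ⟨(a + b) / 2 + (b - a) / 2 * Real.tanh t, |(b - a) / 2| / Real.cosh t⟩

noncomputable def geo (a b t : ℝ) : ℍ := ofComplex (geoC a b t)

lemma geoC_im_pos {a b : ℝ} (h : a ≠ b) (t : ℝ) : 0 < (geoC a b t).im := by
  have h1 : (b - a) / 2 ≠ 0 := div_ne_zero (sub_ne_zero.2 h.symm) two_ne_zero
  exact div_pos (abs_pos.2 h1) (Real.cosh_pos t)

lemma coe_geo {a b : ℝ} (h : a ≠ b) (t : ℝ) : (geo a b t : ℂ) = geoC a b t := by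
  rw [geo, ofComplex_apply_of_im_pos (geoC_im_pos h t)]

lemma dist_geo {a b : ℝ} (h : a ≠ b) (s t : ℝ) : dist (geo a b s) (geo a b t) = |s - t| := by
  have h1 : (b - a) / 2 ≠ 0 := div_ne_zero (sub_ne_zero.2 h.symm) two_ne_zero
  have key : Real.cosh (dist (geo a b s) (geo a b t)) = Real.cosh (s - t) := by
    rw [UpperHalfPlane.cosh_dist, ← UpperHalfPlane.coe_im, ← UpperHalfPlane.coe_im,
      coe_geo h, coe_geo h, Complex.dist_eq, ← Complex.normSq_eq_norm_sq, Complex.normSq_apply,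
      Real.cosh_sub]
    simp only [geoC, Complex.sub_re, Complex.sub_im, Real.tanh_eq_sinh_div_cosh]
    have hs := (Real.cosh_pos s).ne'
    have ht := (Real.cosh_pos t).ne'
    have es := Real.cosh_sq s
    have et := Real.cosh_sq t
    generalize (b - a) / 2 = r at *
    have hr : |r| ≠ 0 := abs_ne_zero.2 h1
    have hr2 : r ^ 2 = |r| ^ 2 := (sq_abs r).symm
    generalize |r| = q at *
    generalize Real.cosh s = cs at *
    generalize Real.cosh t = ct at *
    generalize Real.sinh s = ss at *
    generalize Real.sinh t = st at *
    have e : ((a + b) / 2 + r * (ss / cs) - ((a + b) / 2 + r * (st / ct))) *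
        ((a + b) / 2 + r * (ss / cs) - ((a + b) / 2 + r * (st / ct))) =
        q ^ 2 * (ss / cs - st / ct) ^ 2 := by rw [← hr2]; ring
    rw [e]
    have es' : ss ^ 2 = cs ^ 2 - 1 := by linarith
    have et' : st ^ 2 = ct ^ 2 - 1 := by linarith
    field_simp
    ring_nf
    simp only [es', et']
    ring
  have := Real.cosh_abs (s - t)
  rw [← this] at key
  exact Real.cosh_strictMonoOn.injOn (Set.mem_Ici.2 dist_nonneg) (Set.mem_Ici.2 (abs_nonneg _)) key

lemma one_sub_tanh_sq (t : ℝ) : 1 - Real.tanh t ^ 2 = (1 / Real.cosh t) ^ 2 := by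
  rw [Real.tanh_eq_sinh_div_cosh]
  have := (Real.cosh_pos t).ne'
  field_simp
  linarith [Real.cosh_sq t]

lemma tendsto_sech_top : Tendsto (fun t => 1 / Real.cosh t) atTop (nhds 0) := by
  have h : Tendsto Real.cosh atTop atTop := by
    refine tendsto_atTop_mono (fun t => ?_)
      (Real.tendsto_exp_atTop.atTop_div_const (two_pos : (0 : ℝ) < 2))
    rw [Real.cosh_eq]
    linarith [Real.exp_pos (-t)]
  have h2 := h.inv_tendsto_atTop
  simp only [one_div]
  exact h2

lemma tendsto_tanh_top : Tendsto Real.tanh atTop (nhds 1) := by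
  have h : Tendsto (fun t => √(1 - (1 / Real.cosh t) ^ 2)) atTop (nhds 1) := by
    have := ((tendsto_sech_top.pow 2).const_sub 1).sqrt
    simpa using this
  refine h.congr' ?_
  filter_upwards [eventually_ge_atTop (0 : ℝ)] with t ht
  rw [← one_sub_tanh_sq, sub_sub_cancel, Real.sqrt_sq]
  rw [Real.tanh_eq_sinh_div_cosh]
  exact div_nonneg (Real.sinh_nonneg_iff.2 ht) (Real.cosh_pos t).le

lemma geoC_top (a b : ℝ) : Tendsto (geoC a b) atTop (nhds (b : ℂ)) := by
  have h : Tendsto (fun t => (((a + b) / 2 + (b - a) / 2 * Real.tanh t : ℝ) : ℂ) +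
      ((|(b - a) / 2| * (1 / Real.cosh t) : ℝ) : ℂ) * Complex.I) atTop
      (nhds ((((a + b) / 2 + (b - a) / 2 * 1 : ℝ) : ℂ) +
        ((|(b - a) / 2| * 0 : ℝ) : ℂ) * Complex.I)) := by
    refine Tendsto.add ?_ (Tendsto.mul_const _ ?_)
    · exact (Complex.continuous_ofReal.tendsto _).comp
        ((tendsto_tanh_top.const_mul _).const_add _)
    · exact (Complex.continuous_ofReal.tendsto _).comp (tendsto_sech_top.const_mul _)
  convert h using 2
  · rw [geoC, Complex.mk_eq_add_mul_I, div_eq_mul_one_div |(b - a) / 2|]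
  · push_cast; ring

lemma geoC_neg (a b t : ℝ) : geoC a b (-t) = geoC b a t := by
  apply Complex.ext
  · simp only [geoC, Real.tanh_neg]; ring
  · simp only [geoC, Real.cosh_neg]
    rw [← abs_neg]; congr 2; ring

lemma geoC_bot (a b : ℝ) : Tendsto (geoC a b) atBot (nhds (a : ℂ)) := by
  refine ((geoC_top b a).comp tendsto_neg_atBot_atTop).congr (fun t => ?_)
  rw [Function.comp_apply, geoC_neg]

lemma continuousAt_geo {a b : ℝ} (h : a ≠ b) (t : ℝ) :
    ContinuousAt (fun p : ℝ × ℝ => geo p.1 p.2 t) (a, b) := by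
  have h1 : ContinuousAt (fun p : ℝ × ℝ => geoC p.1 p.2 t) (a, b) := by
    have : (fun p : ℝ × ℝ => geoC p.1 p.2 t) = fun p : ℝ × ℝ =>
        (((p.1 + p.2) / 2 + (p.2 - p.1) / 2 * Real.tanh t : ℝ) : ℂ) +
        ((|(p.2 - p.1) / 2| * (1 / Real.cosh t) : ℝ) : ℂ) * Complex.I := by
      funext p
      rw [geoC, Complex.mk_eq_add_mul_I, div_eq_mul_one_div |(p.2 - p.1) / 2|]
    rw [this]
    fun_prop
  have h2 : ContinuousAt (fun z : ℂ => (ofComplex z : ℍ)) (geoC a b t) := by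
    exact (contMDiffAt_ofComplex (n := 0) (geoC_im_pos h t)).continuousAt
  exact ContinuousAt.comp (f := fun p : ℝ × ℝ => geoC p.1 p.2 t) h2 h1

/-- Real endpoints exist for a pair of points with distinct real parts. -/
lemma exists_geo (z w : ℍ) (h : z.re ≠ w.re) :
    ∃ a b s t : ℝ, a ≠ b ∧ s ≤ t ∧ geo a b s = z ∧ geo a b t = w := by
  obtain ⟨c, hc⟩ : ∃ c : ℝ, (z.re - c) ^ 2 + z.im ^ 2 = (w.re - c) ^ 2 + w.im ^ 2 := by
    have : z.re - w.re ≠ 0 := sub_ne_zero.2 h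
    refine ⟨(z.re ^ 2 + z.im ^ 2 - w.re ^ 2 - w.im ^ 2) / (2 * (z.re - w.re)), ?_⟩
    field_simp
    ring
  have hz := z.im_pos
  have hw := w.im_pos
  obtain ⟨r, hr, hlt⟩ : ∃ r : ℝ, r ^ 2 = (z.re - c) ^ 2 + z.im ^ 2 ∧
      (z.re - c) / r < (w.re - c) / r := by
    have hp : 0 < (z.re - c) ^ 2 + z.im ^ 2 := by positivity
    have hs := Real.sqrt_pos.2 hp
    rcases lt_or_gt_of_ne h with h | h
    · exact ⟨_, Real.sq_sqrt hp.le, div_lt_div_of_pos_right (by linarith) hs⟩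
    · refine ⟨-√((z.re - c) ^ 2 + z.im ^ 2), by rw [neg_sq, Real.sq_sqrt hp.le], ?_⟩
      exact div_lt_div_of_neg_of_lt (by linarith) (by linarith)
  have hr0 : r ≠ 0 := by rintro rfl; simp at hlt
  have main : ∀ u : ℍ, r ^ 2 = (u.re - c) ^ 2 + u.im ^ 2 →
      (u.re - c) / r ∈ Set.Ioo (-1 : ℝ) 1 ∧
        geo (c - r) (c + r) (Real.artanh ((u.re - c) / r)) = u := by
    intro u hu
    have hup := u.im_pos
    have hm : (u.re - c) / r ∈ Set.Ioo (-1 : ℝ) 1 := by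
      rw [Set.mem_Ioo, ← abs_lt, ← sq_lt_one_iff_abs_lt_one, div_pow, div_lt_one (by positivity)]
      nlinarith
    refine ⟨hm, ?_⟩
    have hab : c - r ≠ c + r := fun hh => hr0 (by linarith)
    have ht := Real.tanh_artanh hm
    have hq := one_sub_tanh_sq (Real.artanh ((u.re - c) / r))
    apply UpperHalfPlane.ext
    rw [coe_geo hab]
    apply Complex.ext
    · simp only [geoC, ht, UpperHalfPlane.coe_re]
      field_simp
      ring
    · simp only [geoC, UpperHalfPlane.coe_im]
      rw [ht] at hq
      have e : (c + r - (c - r)) / 2 = r := by ring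
      rw [e, ← sq_eq_sq₀ (div_nonneg (abs_nonneg _) (Real.cosh_pos _).le) hup.le, div_eq_mul_one_div,
        mul_pow, ← hq, sq_abs]
      field_simp
      linarith
  obtain ⟨mz, gz⟩ := main z hr
  obtain ⟨mw, gw⟩ := main w (hr.trans hc)
  exact ⟨c - r, c + r, _, _, fun hh => hr0 (by linarith),
    (Real.strictMonoOn_artanh mz mw hlt).le, gz, gw⟩

lemma exists_near (z w : ℍ) (ε : ℝ) (hε : 0 < ε) : ∃ w' : ℍ, dist w' w < ε ∧ z.re ≠ w'.re := by
  by_cases h : z.re = w.re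
  · have hw := w.im_pos
    refine ⟨(ε / 2 * w.im) +ᵥ w, ?_, ?_⟩
    · refine (dist_le_dist_coe_div_sqrt _ _).trans_lt ?_
      rw [UpperHalfPlane.vadd_im, Real.sqrt_mul_self hw.le, UpperHalfPlane.coe_vadd,
        Complex.dist_eq, add_sub_cancel_right, Complex.norm_real, Real.norm_eq_abs,
        abs_of_pos (by positivity), div_lt_iff₀ hw]
      nlinarith
    · rw [UpperHalfPlane.vadd_re, h]
      have : 0 < ε / 2 * w.im := by positivity
      linarith
  · exact ⟨w, by simpa using hε, h⟩

/-- Density of geodesics with rational endpoints in the hyperbolic plane: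
any ordered pair of points of `ℍ` can be `ε`-approximated, in order, along a
unit-speed geodesic line whose two endpoints on the real axis are distinct
rational numbers. -/
theorem geodesics_with_rational_endpoints_dense
    (z w : ℍ) (ε : ℝ) (hε : 0 < ε) :
    ∃ (a b : ℚ), a ≠ b ∧
      ∃ γ : ℝ → ℍ,
        (∀ s t : ℝ, dist (γ s) (γ t) = |s - t|) ∧
        Tendsto (fun t => (γ t : ℂ)) atBot (nhds ((a : ℝ) : ℂ)) ∧
        Tendsto (fun t => (γ t : ℂ)) atTop (nhds ((b : ℝ) : ℂ)) ∧
        ∃ s t : ℝ, s ≤ t ∧ dist (γ s) z < ε ∧ dist (γ t) w < ε := by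
  obtain ⟨w', hw', hne⟩ := exists_near z w ε hε
  obtain ⟨a, b, s, t, hab, hst, hs, ht⟩ := exists_geo z w' hne
  have e1 : ∀ᶠ p : ℝ × ℝ in nhds (a, b), p.1 ≠ p.2 :=
    (isOpen_ne_fun continuous_fst continuous_snd).mem_nhds hab
  have e2 : ∀ᶠ p : ℝ × ℝ in nhds (a, b), dist (geo p.1 p.2 s) z < ε :=
    ((continuousAt_geo hab s).dist continuousAt_const).eventually_lt_const (by simpa [hs] using hε)
  have e3 : ∀ᶠ p : ℝ × ℝ in nhds (a, b), dist (geo p.1 p.2 t) w < ε :=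
    ((continuousAt_geo hab t).dist continuousAt_const).eventually_lt_const (by simpa [ht] using hw')
  have hd : DenseRange (Prod.map ((↑) : ℚ → ℝ) ((↑) : ℚ → ℝ)) :=
    Rat.denseRange_cast.prodMap Rat.denseRange_cast
  obtain ⟨_, ⟨h1, h2, h3⟩, ⟨⟨a', b'⟩, rfl⟩⟩ :=
    mem_closure_iff_nhds.1 (hd (a, b)) _ (e1.and (e2.and e3))
  simp only [Prod.map] at h1 h2 h3
  refine ⟨a', b', fun h => h1 (by rw [h]), geo a' b', dist_geo h1, ?_, ?_, s, t, hst, h2, h3⟩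
  · simp only [coe_geo h1]
    exact geoC_bot _ _
  · simp only [coe_geo h1]
    exact geoC_top _ _
end

section
/- There exists a unit-speed geodesic line γ : ℝ → ℍ whose projection is dense in the modular surface in the directed sense: for all z, w ∈ ℍ and every ε > 0 there exist g ∈ SL(2,ℤ) and parameters s ≤ t with dist(γ(s), g·z) < ε and dist(γ(t), g·w) < ε. -/
open UpperHalfPlane Set Filter Matrix

namespace GeoDense

/-- The point `x + i y`. -/
noncomputable def P (x y : ℝ) (hy : 0 < y) : ℍ := UpperHalfPlane.mk ⟨x, y⟩ hy

/-- The downward vertical geodesic ending at `x`. -/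
noncomputable def line (x t : ℝ) : ℍ := P x (Real.exp (-t)) (Real.exp_pos _)

lemma P_coe (x y : ℝ) (hy : 0 < y) : ((P x y hy : ℍ) : ℂ) = x + y * Complex.I := by
  apply Complex.ext <;> simp [P]

lemma dist_line (x s t : ℝ) : dist (line x s) (line x t) = |s - t| := by
  have := (isometry_vertical_line x).dist_eq (-s) (-t)
  unfold line P
  rw [this, Real.dist_eq, abs_sub_comm]
  congr 1; ring

lemma line_eq (x y : ℝ) (hy : 0 < y) : line x (-Real.log y) = P x y hy := by
  unfold line
  congr 1
  rw [neg_neg, Real.exp_log hy]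

/-- Integer matrices of determinant one from their entries. -/
def mkSL (a b c d : ℤ) (h : a * d - b * c = 1) : SpecialLinearGroup (Fin 2) ℤ :=
  ⟨!![a, b; c, d], by rw [Matrix.det_fin_two_of]; exact h⟩

lemma smul_coe (a b c d : ℤ) (h : a * d - b * c = 1) (z : ℍ) :
    ((mkSL a b c d h • z : ℍ) : ℂ) = (a * (z : ℂ) + b) / (c * z + d) := by
  rw [UpperHalfPlane.coe_specialLinearGroup_apply]
  simp [mkSL]

lemma dist_sl (g : SpecialLinearGroup (Fin 2) ℤ) (z w : ℍ) : dist (g • z) (g • w) = dist z w := by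
  have h : ∀ τ : ℍ, g • τ = (SpecialLinearGroup.map (Int.castRingHom ℝ) g) • τ := by
    intro τ
    ext
    rw [UpperHalfPlane.coe_specialLinearGroup_apply, UpperHalfPlane.coe_specialLinearGroup_apply]
    simp
  rw [h, h, dist_smul]

lemma push_dist (p r q s : ℤ) (h : p * s - r * q = 1) (b y M : ℝ) (hy : 0 < y)
    (hM : M = q * b + s) (hM0 : 0 < M) (hq : (0 : ℝ) < q) (hy' : 0 < y * (1 / M ^ 2)) :
    dist (P (p / q - 1 / (q * M)) (y * (1 / M ^ 2)) hy') (mkSL p r q s h • P b y hy)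
      ≤ q * y / M := by
  have hR : (p : ℝ) * s - r * q = 1 := by exact_mod_cast h
  have hx : (p : ℝ) / q - 1 / (q * M) = (p * b + r) / M := by
    field_simp
    rw [hM]; linear_combination hR
  set D : ℂ := M + q * y * Complex.I with hD
  have hDim : D.im = q * y := by simp [hD]
  have hD0 : D ≠ 0 := by
    intro h0
    rw [h0] at hDim
    simp at hDim
    rcases hDim with h1 | h1
    · rw [h1] at hq; simp at hq
    · exact hy.ne' h1
  have hDn : 0 < ‖D‖ := norm_pos_iff.mpr hD0
  have hMC : (M : ℂ) ≠ 0 := by exact_mod_cast hM0.ne'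
  have hPc : ((P b y hy : ℍ) : ℂ) = b + y * Complex.I := by
    apply Complex.ext <;> simp [P]
  have hDe : (q : ℂ) * (P b y hy : ℍ) + s = D := by
    rw [hPc, hD, hM]; push_cast; ring
  have hcoe : ((mkSL p r q s h • P b y hy : ℍ) : ℂ) = (p * (b + y * Complex.I) + r) / D := by
    rw [smul_coe, hDe, hPc]
  have hRC : (p : ℂ) * s - r * q = 1 := by exact_mod_cast h
  have hMC' : (M : ℂ) = q * b + s := by rw [hM]; push_cast; ring
  have hdiff : ((P (p / q - 1 / (q * M)) (y * (1 / M ^ 2)) hy' : ℍ) : ℂ)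
      - (mkSL p r q s h • P b y hy : ℍ) = -(q * y ^ 2 : ℝ) / (M ^ 2 * D) := by
    have : ((P (p / q - 1 / (q * M)) (y * (1 / M ^ 2)) hy' : ℍ) : ℂ)
      = (p * b + r) / M + y / M ^ 2 * Complex.I := by
      have e1 : ((P (p / q - 1 / (q * M)) (y * (1 / M ^ 2)) hy' : ℍ) : ℂ)
        = ((p / q - 1 / (q * M) : ℝ) : ℂ) + ((y * (1 / M ^ 2) : ℝ) : ℂ) * Complex.I := by
        exact P_coe _ _ _
      rw [e1, hx]; push_cast; ring
    rw [this, hcoe]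
    field_simp
    push_cast
    rw [hD]
    have hI := Complex.I_sq
    linear_combination (q * y ^ 2 : ℂ) * hI
      + (-(M : ℂ) * y * Complex.I) * hRC - (M * y * Complex.I * p : ℂ) * hMC'
  have him : (mkSL p r q s h • P b y hy).im = y / ‖D‖ ^ 2 := by
    rw [← UpperHalfPlane.coe_im, hcoe, Complex.div_im, ← Complex.normSq_eq_norm_sq]
    have : D.re = M := by simp [hD]
    rw [this, hDim]
    simp
    rw [← sub_div]
    congr 1
    rw [hM]; linear_combination y * hR
  refine (UpperHalfPlane.dist_le_dist_coe_div_sqrt _ _).trans (le_of_eq ?_)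
  rw [Complex.dist_eq, hdiff, him]
  have h1 : (P (p / q - 1 / (q * M)) (y * (1 / M ^ 2)) hy').im = y * (1 / M ^ 2) := rfl
  have h2 : y * (1 / M ^ 2) * (y / ‖D‖ ^ 2) = (y / (M * ‖D‖)) ^ 2 := by field_simp
  rw [h1, h2, Real.sqrt_sq (by positivity), norm_div, norm_neg, norm_mul, norm_pow,
    Complex.norm_real, Complex.norm_real, Real.norm_of_nonneg (by positivity),
    Real.norm_of_nonneg hM0.le]
  field_simp

lemma exists_push (b x0 δ ε y1 y2 : ℝ) (hδ : 0 < δ) (hε : 0 < ε) (hy1 : 0 < y1) (hy2 : 0 < y2) :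
    ∃ (g : SpecialLinearGroup (Fin 2) ℤ) (x m : ℝ) (hm : 0 < m), |x - x0| < δ ∧
      dist (P x (y1 * m) (mul_pos hy1 hm)) (g • P b y1 hy1) < ε ∧
      dist (P x (y2 * m) (mul_pos hy2 hm)) (g • P b y2 hy2) < ε := by
  obtain ⟨r, hr1, hr2⟩ := exists_rat_btwn (show x0 - δ/2 < x0 + δ/2 by linarith)
  have hcop : IsCoprime r.num (r.den : ℤ) := by
    rw [Int.isCoprime_iff_gcd_eq_one]; exact r.reduced
  obtain ⟨u, v, huv⟩ := hcop
  set p : ℤ := r.num with hp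
  set q : ℤ := (r.den : ℤ) with hq
  have hq0 : (0 : ℝ) < q := by
    rw [hq]; exact_mod_cast r.den_pos
  have hrpq : (r : ℝ) = p / q := by
    rw [hp, hq]; push_cast; exact_mod_cast (Rat.num_div_den r).symm
  obtain ⟨n, hn⟩ := exists_nat_gt ((1 / (q * (δ / 2)) + q * y1 / ε + q * y2 / ε - u) / q - b)
  set M : ℝ := q * (b + n) + u with hM
  have hMlt : 1 / (q * (δ / 2)) + q * y1 / ε + q * y2 / ε < M := by
    have : (1 / (q * (δ / 2)) + q * y1 / ε + q * y2 / ε - u) / q < b + n := by linarith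
    rw [div_lt_iff₀ hq0] at this
    rw [hM]; linarith
  have t1 : 0 < 1 / (q * (δ / 2)) := by positivity
  have t2 : 0 < q * y1 / ε := by positivity
  have t3 : 0 < q * y2 / ε := by positivity
  have hM0 : 0 < M := by linarith
  have hdet : p * (q * n + u) - (p * n - v) * q = 1 := by linarith
  have hMe : M = q * b + ((q * n + u : ℤ) : ℝ) := by rw [hM]; push_cast; ring
  refine ⟨mkSL _ _ _ _ hdet, p / q - 1 / (q * M), 1 / M ^ 2, by positivity, ?_, ?_, ?_⟩
  · have h1 : 1 / (q * M) < δ / 2 := by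
      have : 1 / (q * (δ / 2)) < M := by linarith
      rw [div_lt_iff₀ (by positivity)] at this ⊢
      linarith
    have h2 : 0 < 1 / (q * M) := by positivity
    rw [hrpq] at hr1 hr2
    rw [abs_lt]; constructor <;> linarith
  · refine (push_dist _ _ _ _ hdet b y1 M hy1 hMe hM0 hq0 _).trans_lt ?_
    rw [div_lt_iff₀ hM0, ← div_lt_iff₀' hε]; linarith
  · refine (push_dist _ _ _ _ hdet b y2 M hy2 hMe hM0 hq0 _).trans_lt ?_
    rw [div_lt_iff₀ hM0, ← div_lt_iff₀' hε]; linarith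

/-- `-1/(z-p)`. -/
noncomputable def F (p : ℝ) (z : ℍ) : ℍ := ModularGroup.S • ((-p) +ᵥ z)

lemma F_coe (p : ℝ) (z : ℍ) : (F p z : ℂ) = (-((z : ℂ) - p))⁻¹ := by
  unfold F
  rw [UpperHalfPlane.modular_S_smul]
  simp
  ring_nf

lemma dist_F (p p' : ℝ) (z : ℍ) : dist (F p z) (F p' z) ≤ |p - p'| / z.im := by
  have h1 : dist (F p z) (F p' z) = dist ((-p) +ᵥ z) ((-p') +ᵥ z) := dist_sl _ _ _
  rw [h1]
  refine (UpperHalfPlane.dist_le_dist_coe_div_sqrt _ _).trans (le_of_eq ?_)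
  rw [UpperHalfPlane.vadd_im, UpperHalfPlane.vadd_im, Real.sqrt_mul_self z.im_pos.le]
  congr 1
  rw [UpperHalfPlane.coe_vadd, UpperHalfPlane.coe_vadd, dist_add_right, Complex.dist_eq,
    ← Complex.ofReal_sub, Complex.norm_real, Real.norm_eq_abs, abs_sub_comm]
  congr 1; ring

lemma F_re (p : ℝ) (z : ℍ) : (F p z).re = -(z.re - p) / ((z.re - p) ^ 2 + z.im ^ 2) := by
  rw [← UpperHalfPlane.coe_re, F_coe, Complex.inv_re]
  simp [Complex.normSq_apply]
  ring_nf

lemma F_im (p : ℝ) (z : ℍ) : (F p z).im = z.im / ((z.re - p) ^ 2 + z.im ^ 2) := by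
  rw [← UpperHalfPlane.coe_im, F_coe, Complex.inv_im]
  simp [Complex.normSq_apply]
  ring_nf

lemma exists_endpoint (z w : ℍ) : (z.re = w.re ∧ w.im ≤ z.im) ∨
    ∃ p : ℝ, (F p z).re = (F p w).re ∧ (F p w).im ≤ (F p z).im := by
  have hz := z.im_pos
  have hw := w.im_pos
  by_cases h : z.re = w.re
  · by_cases h2 : w.im ≤ z.im
    · exact Or.inl ⟨h, h2⟩
    · right
      refine ⟨z.re, ?_, ?_⟩
      · rw [F_re, F_re, h]; simp
      · rw [F_im, F_im, h, div_le_div_iff₀ (by positivity) (by positivity)]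
        push Not at h2
        nlinarith [mul_pos hz hw]
  · right
    have key : ∃ c R : ℝ, 0 < R ∧ (z.re - c) ^ 2 + z.im ^ 2 = R ^ 2 ∧
        (w.re - c) ^ 2 + w.im ^ 2 = R ^ 2 := by
      have hne : z.re - w.re ≠ 0 := sub_ne_zero.mpr h
      set c := (z.re ^ 2 + z.im ^ 2 - w.re ^ 2 - w.im ^ 2) / (2 * (z.re - w.re)) with hc
      have hc' : c * (2 * (z.re - w.re)) = z.re ^ 2 + z.im ^ 2 - w.re ^ 2 - w.im ^ 2 := by
        rw [hc]; field_simp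
      refine ⟨c, √((z.re - c) ^ 2 + z.im ^ 2), by positivity, ?_, ?_⟩
      · rw [Real.sq_sqrt (by positivity)]
      · rw [Real.sq_sqrt (by positivity)]; linarith
    obtain ⟨c, R, hR, h1, h2⟩ := key
    have hσ : ∃ σ : ℝ, σ ^ 2 = 1 ∧ σ * (w.re - c) ≤ σ * (z.re - c) := by
      rcases le_total (w.re - c) (z.re - c) with h | h
      · exact ⟨1, by norm_num, by linarith⟩
      · exact ⟨-1, by norm_num, by linarith⟩
    obtain ⟨σ, hσ1, hσ2⟩ := hσ
    have hden : ∀ v : ℍ, (v.re - c) ^ 2 + v.im ^ 2 = R ^ 2 →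
        0 < R - σ * (v.re - c) ∧ 0 < R + σ * (v.re - c) ∧
        v.im ^ 2 = (R - σ * (v.re - c)) * (R + σ * (v.re - c)) ∧
        (v.re - (c + σ * R)) ^ 2 + v.im ^ 2 = 2 * R * (R - σ * (v.re - c)) := by
      intro v hv
      have hvp := v.im_pos
      have : (σ * (v.re - c)) ^ 2 < R ^ 2 := by
        rw [mul_pow, hσ1]; nlinarith
      have := abs_lt_of_sq_lt_sq' this hR.le
      refine ⟨by linarith, by linarith, ?_, ?_⟩
      · linear_combination hv + (v.re - c) ^ 2 * hσ1
      · linear_combination hv + R ^ 2 * hσ1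
    obtain ⟨a1, a2, a3, a4⟩ := hden z h1
    obtain ⟨b1, b2, b3, b4⟩ := hden w h2
    refine ⟨c + σ * R, ?_, ?_⟩
    · rw [F_re, F_re, a4, b4, div_eq_div_iff (by positivity) (by positivity)]
      linear_combination 2 * R * R * (z.re - w.re) * (hσ1)
    · rw [F_im, F_im, a4, b4, div_le_div_iff₀ (by positivity) (by positivity)]
      have : w.im * (R - σ * (z.re - c)) ≤ z.im * (R - σ * (w.re - c)) := by
        refine le_of_sq_le_sq ?_ (by positivity)
        rw [mul_pow, mul_pow, a3, b3]
        generalize σ * (z.re - c) = A at *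
        generalize σ * (w.re - c) = B at *
        have : (R + B) * (R - A) ≤ (R + A) * (R - B) := by nlinarith
        have := mul_le_mul_of_nonneg_left this (mul_pos a1 b1).le
        linarith
      nlinarith

lemma exists_vertical (z w : ℍ) (ε : ℝ) (hε : 0 < ε) :
    ∃ (g : SpecialLinearGroup (Fin 2) ℤ) (b y1 y2 : ℝ) (h1 : 0 < y1) (h2 : 0 < y2), y2 ≤ y1 ∧
      dist (P b y1 h1) (g • z) < ε ∧ dist (P b y2 h2) (g • w) < ε := by
  rcases exists_endpoint z w with ⟨h1, h2⟩ | ⟨p, h1, h2⟩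
  · refine ⟨1, z.re, z.im, w.im, z.im_pos, w.im_pos, h2, ?_, ?_⟩
    · have : P z.re z.im z.im_pos = z := by ext <;> rfl
      rw [this, one_smul, dist_self]; exact hε
    · have : P z.re w.im w.im_pos = w := by
        apply UpperHalfPlane.ext_re_im
        · exact h1
        · rfl
      rw [this, one_smul, dist_self]; exact hε
  · have hz := z.im_pos
    have hw := w.im_pos
    have hη : 0 < ε * min z.im w.im := by positivity
    obtain ⟨r, hr1, hr2⟩ := exists_rat_btwn
      (show p - ε * min z.im w.im < p by linarith)
    have hpr : |p - r| < ε * min z.im w.im := by rw [abs_lt]; constructor <;> linarith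
    have dz : dist (F p z) (F r z) < ε := by
      refine (dist_F _ _ _).trans_lt ?_
      rw [div_lt_iff₀ hz]
      exact hpr.trans_le (by gcongr; exact min_le_left _ _)
    have dw : dist (F p w) (F r w) < ε := by
      refine (dist_F _ _ _).trans_lt ?_
      rw [div_lt_iff₀ hw]
      exact hpr.trans_le (by gcongr; exact min_le_right _ _)
    have hcop : IsCoprime r.num (r.den : ℤ) := by
      rw [Int.isCoprime_iff_gcd_eq_one]; exact r.reduced
    obtain ⟨u, v, huv⟩ := hcop
    set m : ℤ := r.num with hm
    set l : ℤ := (r.den : ℤ) with hl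
    have hl0 : (0 : ℝ) < l := by
      rw [hl]; exact_mod_cast r.den_pos
    have hrml : (r : ℝ) = m / l := by
      rw [hm, hl]; push_cast; exact_mod_cast (Rat.num_div_den r).symm
    have hdet : (-u) * (-m) - (-v) * l = 1 := by linarith
    have huv' : (u : ℂ) * m + v * l = 1 := by exact_mod_cast huv
    have hs : (0 : ℝ) < 1 / l ^ 2 := by positivity
    let A : ℍ → ℍ := fun τ => (-u / l : ℝ) +ᵥ ((⟨1 / (l:ℝ) ^ 2, hs⟩ : {x : ℝ // 0 < x}) • τ)
    have hA : Isometry A := (isometry_real_vadd _).comp (isometry_pos_mul _)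
    have hk : ∀ τ : ℍ, mkSL _ _ _ _ hdet • τ = A (F r τ) := by
      intro τ
      have hlC : (l : ℂ) ≠ 0 := by exact_mod_cast hl0.ne'
      have hne : (l : ℂ) * τ - m ≠ 0 := by
        intro h0
        have := congrArg Complex.im h0
        simp at this
        rcases this with h | h
        · rw [h] at hl0; simp at hl0
        · exact τ.im_pos.ne' h
      have hne2 : (m : ℂ) - l * τ ≠ 0 := by
        rw [← neg_sub]; exact neg_ne_zero.mpr hne
      ext
      rw [smul_coe]
      simp only [A]
      rw [UpperHalfPlane.coe_vadd, UpperHalfPlane.coe_pos_real_smul, F_coe, hrml,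
        Complex.real_smul]
      push_cast
      have e1 : (-((τ : ℂ) - m / l))⁻¹ = l / (m - l * τ) := by
        rw [inv_eq_one_div, div_eq_div_iff _ hne2]
        · field_simp; ring
        · intro h0
          apply hne2
          field_simp at h0
          linear_combination h0
      have e2 : (l : ℂ) * τ + -m ≠ 0 := by rwa [← sub_eq_add_neg]
      rw [e1, div_eq_iff e2]
      have e3 : (m - l * τ : ℂ) = -(l * τ + -m) := by ring
      have e4 : -(u : ℂ) * τ + -v = (-u * (l * τ + -m) - 1) / l := by
        rw [eq_div_iff hlC]; linear_combination (-1 : ℂ) * huv'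
      rw [e3]
      push_cast at e2 ⊢
      rw [e4]
      generalize (l : ℂ) * τ + -m = E at *
      field_simp
      ring
    have hAP : ∀ τ : ℍ, A τ = P (-u / l + 1 / (l:ℝ) ^ 2 * τ.re) (1 / (l:ℝ) ^ 2 * τ.im)
        (mul_pos hs τ.im_pos) := by
      intro τ
      apply UpperHalfPlane.ext_re_im
      · simp [A, P]
      · simp [A, P]
    refine ⟨mkSL _ _ _ _ hdet, -u / l + 1 / (l:ℝ) ^ 2 * (F p z).re, 1 / (l:ℝ) ^ 2 * (F p z).im,
      1 / (l:ℝ) ^ 2 * (F p w).im, mul_pos hs (F p z).im_pos, mul_pos hs (F p w).im_pos,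
      by gcongr, ?_, ?_⟩
    · rw [← hAP, hk, hA.dist_eq]; exact dz
    · have := hAP (F p w)
      rw [← h1] at this
      rw [← this, hk, hA.dist_eq]; exact dw

/-- Endpoints whose vertical geodesic passes near some translate of the pair. -/
def U (z w : ℍ) (ε : ℝ) : Set ℝ := {x | ∃ g : SpecialLinearGroup (Fin 2) ℤ, ∃ s t : ℝ, s ≤ t ∧
          dist (line x s) (g • z) < ε ∧ dist (line x t) (g • w) < ε}

lemma continuous_line (s : ℝ) : Continuous fun x => line x s := by
  have : (fun x => line x s) = fun x : ℝ => x +ᵥ line 0 s := by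
    funext x
    apply UpperHalfPlane.ext_re_im <;> simp [line, P]
  rw [this]
  rw [UpperHalfPlane.isEmbedding_coe.continuous_iff]
  simp only [Function.comp_def, UpperHalfPlane.coe_vadd]
  fun_prop

lemma isOpen_U (z w : ℍ) (ε : ℝ) : IsOpen (U z w ε) := by
  have : U z w ε = ⋃ (g : SpecialLinearGroup (Fin 2) ℤ), ⋃ (s : ℝ), ⋃ (t : ℝ), ⋃ (_ : s ≤ t),
      {x | dist (line x s) (g • z) < ε} ∩ {x | dist (line x t) (g • w) < ε} := by
    ext x; simp only [U, mem_iUnion, mem_inter_iff, mem_ofPred_eq, exists_prop]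
  rw [this]
  refine isOpen_iUnion fun g => isOpen_iUnion fun s => isOpen_iUnion fun t => isOpen_iUnion fun _ => ?_
  exact (isOpen_lt ((continuous_line s).dist continuous_const) continuous_const).inter
    (isOpen_lt ((continuous_line t).dist continuous_const) continuous_const)

lemma dense_U (z w : ℍ) (ε : ℝ) (hε : 0 < ε) : Dense (U z w ε) := by
  rw [Metric.dense_iff]
  intro x0 δ hδ
  obtain ⟨k, b, y1, y2, h1, h2, h12, hz, hw⟩ := exists_vertical z w (ε / 2) (by linarith)
  obtain ⟨g, x, m, hm, hx, hz', hw'⟩ := exists_push b x0 δ (ε / 2) y1 y2 hδ (by linarith) h1 h2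
  refine ⟨x, by rw [Metric.mem_ball, Real.dist_eq]; exact hx, g * k,
    -Real.log (y1 * m), -Real.log (y2 * m), ?_, ?_, ?_⟩
  · have := Real.log_le_log (mul_pos h2 hm) (mul_le_mul_of_nonneg_right h12 hm.le)
    linarith
  · rw [line_eq _ _ (mul_pos h1 hm), mul_smul]
    refine (dist_triangle _ (g • P b y1 h1) _).trans_lt ?_
    rw [dist_sl]; linarith
  · rw [line_eq _ _ (mul_pos h2 hm), mul_smul]
    refine (dist_triangle _ (g • P b y2 h2) _).trans_lt ?_
    rw [dist_sl]; linarith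

end GeoDense

open GeoDense in
/-- Counterpart of the paper's main Theorem 3.2 for the modular surface:
there exists a unit-speed geodesic line in the hyperbolic plane whose projection
is dense in the modular surface in the directed sense. -/
theorem exists_geodesic_dense_in_modular_surface_directed :
    ∃ γ : ℝ → ℍ,
      (∀ s t : ℝ, dist (γ s) (γ t) = |s - t|) ∧
      ∀ z w : ℍ, ∀ ε : ℝ, 0 < ε →
        ∃ g : SpecialLinearGroup (Fin 2) ℤ, ∃ s t : ℝ, s ≤ t ∧
          dist (γ s) (g • z) < ε ∧ dist (γ t) (g • w) < ε := by
  let e := TopologicalSpace.denseSeq ℍ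
  have he : DenseRange e := TopologicalSpace.denseRange_denseSeq ℍ
  have hd : Dense (⋂ i : ℕ × ℕ × ℕ, U (e i.1) (e i.2.1) (1 / ((i.2.2 : ℝ) + 1))) :=
    dense_iInter_of_isOpen (fun i => isOpen_U _ _ _)
      (fun i => dense_U _ _ _ (by positivity))
  obtain ⟨x, hx⟩ := hd.nonempty
  refine ⟨line x, dist_line x, ?_⟩
  intro z w ε hε
  obtain ⟨n, hn⟩ := exists_nat_one_div_lt (show 0 < ε / 2 by linarith)
  obtain ⟨i, hi⟩ := he.exists_dist_lt z (show 0 < ε / 2 by linarith)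
  obtain ⟨j, hj⟩ := he.exists_dist_lt w (show 0 < ε / 2 by linarith)
  obtain ⟨g, s, t, hst, h1, h2⟩ := mem_iInter.mp hx (i, j, n)
  refine ⟨g, s, t, hst, ?_, ?_⟩
  · refine (dist_triangle _ (g • e i) _).trans_lt ?_
    rw [dist_sl, dist_comm (e i)]
    simp only at h1
    linarith
  · refine (dist_triangle _ (g • e j) _).trans_lt ?_
    rw [dist_sl, dist_comm (e j)]
    simp only at h2
    linarith
end

section
/- There exists a unit-speed geodesic line γ : ℝ → ℍ such that the image of γ(ℝ) under the quotient map from ℍ to the quotient of ℍ by the SL(2,ℤ)-action (with the quotient topology) is dense in the quotient. -/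
open UpperHalfPlane Set Filter Matrix

/-- The vertical geodesic line with real part `x`. -/
noncomputable def vertLine (x t : ℝ) : ℍ :=
  ⟨⟨x, Real.exp t⟩, Real.exp_pos t⟩

lemma continuous_vertLine (t : ℝ) : Continuous fun x => vertLine x t := by
  rw [isEmbedding_coe.continuous_iff]
  have : (UpperHalfPlane.coe ∘ fun x => vertLine x t)
      = fun x : ℝ => (x : ℂ) + (Real.exp t : ℂ) * Complex.I := by
    funext x
    exact Complex.mk_eq_add_mul_I _ _
  rw [this]
  fun_prop

lemma vertLine_re_log_im (z : ℍ) : vertLine z.re (Real.log z.im) = z := by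
  apply UpperHalfPlane.ext
  apply Complex.ext
  · rfl
  · exact Real.exp_log z.im_pos

lemma dist_vertLine (x s t : ℝ) : dist (vertLine x s) (vertLine x t) = |s - t| := by
  rw [UpperHalfPlane.dist_of_re_eq (show (vertLine x s).re = (vertLine x t).re from rfl)]
  change dist (Real.log (Real.exp s)) (Real.log (Real.exp t)) = _
  rw [Real.log_exp, Real.log_exp, Real.dist_eq]

lemma continuous_modular_smul (g : SpecialLinearGroup (Fin 2) ℤ) :
    Continuous fun z : ℍ => g • z := by
  have h : ∀ z : ℍ, g • z = (SpecialLinearGroup.map (Int.castRingHom ℝ) g) • z := by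
    intro z
    apply UpperHalfPlane.ext
    rw [coe_specialLinearGroup_apply, coe_specialLinearGroup_apply]
    simp
  simp_rw [h]
  exact continuous_const_smul _

/-- Real parts of an orbit are dense. -/
lemma exists_smul_re_near (z : ℍ) (x ε : ℝ) (hε : 0 < ε) :
    ∃ g : SpecialLinearGroup (Fin 2) ℤ, |(g • z).re - x| < ε := by
  obtain ⟨r, hr1, hr2⟩ := exists_rat_btwn (show x - ε / 2 < x + ε / 2 by linarith)
  have hq : (0 : ℝ) < r.den := by exact_mod_cast r.den_pos
  have hq1 : (1 : ℝ) ≤ r.den := by exact_mod_cast r.den_pos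
  have hcop : IsCoprime r.num (r.den : ℤ) := Rat.isCoprime_num_den r
  obtain ⟨u, v, huv⟩ := hcop
  obtain ⟨k, hk⟩ := exists_nat_gt (2 / ε + |z.re| + |(u : ℝ)|)
  let M : Matrix (Fin 2) (Fin 2) ℤ :=
    !![r.num, -v + k * r.num; (r.den : ℤ), u + k * r.den]
  have hM : M.det = 1 := by
    rw [Matrix.det_fin_two_of]
    linear_combination huv
  refine ⟨⟨M, hM⟩, ?_⟩
  set g : SpecialLinearGroup (Fin 2) ℤ := ⟨M, hM⟩
  set w : ℂ := (r.den : ℂ) * z + (u + k * r.den) with hw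
  have hwre : w.re = r.den * (z.re + k) + u := by
    simp [hw]; ring
  have hzk : 0 ≤ z.re + k := by
    have := neg_abs_le z.re
    have := abs_nonneg (u : ℝ)
    have : 0 < 2 / ε := by positivity
    linarith
  have hbig : 2 / ε < w.re := by
    have h1 := neg_abs_le z.re
    have h2 := neg_abs_le (u : ℝ)
    nlinarith
  have hwn : 2 / ε < ‖w‖ := hbig.trans_le ((le_abs_self _).trans (Complex.abs_re_le_norm w))
  have hwpos : 0 < ‖w‖ := lt_trans (by positivity) hwn
  have hw0 : w ≠ 0 := norm_pos_iff.mp hwpos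
  have hqc : (r.den : ℂ) ≠ 0 := by exact_mod_cast r.den_nz
  have hform : ((g • z : ℍ) : ℂ) - ((r : ℝ) : ℂ) = -1 / (r.den * w) := by
    have hrr : ((r : ℝ) : ℂ) = (r.num : ℂ) / r.den := by
      rw [Complex.ofReal_ratCast]
      exact Rat.cast_def r
    have hc : (u : ℂ) * r.num + v * r.den = 1 := by exact_mod_cast huv
    have hg : ((g • z : ℍ) : ℂ) = (r.num * z + (-v + k * r.num)) / w := by
      rw [coe_specialLinearGroup_apply]
      simp [g, M, hw]
    rw [hg, hrr, div_sub_div _ _ hw0 hqc, div_eq_div_iff (mul_ne_zero hw0 hqc)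
      (mul_ne_zero hqc hw0)]
    rw [hw]
    linear_combination (-(r.den : ℂ) * (r.den * z + (u + k * r.den))) * hc
  have hnorm : ‖((g • z : ℍ) : ℂ) - ((r : ℝ) : ℂ)‖ < ε / 2 := by
    rw [hform, norm_div, norm_mul, norm_neg, norm_one, Complex.norm_natCast]
    rw [div_lt_iff₀ (by positivity)]
    rw [div_lt_iff₀ hε] at hwn
    nlinarith
  have hre : |(g • z).re - r| < ε / 2 := by
    refine lt_of_le_of_lt ?_ hnorm
    have := Complex.abs_re_le_norm (((g • z : ℍ) : ℂ) - ((r : ℝ) : ℂ))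
    simpa using this
  rw [abs_lt] at hre ⊢
  constructor <;> linarith [hre.1, hre.2]

/-- There exists a unit-speed geodesic line in the hyperbolic plane whose image in
the quotient of `ℍ` by the `SL(2,ℤ)`-action (with the quotient topology) is dense. -/
theorem exists_geodesic_with_dense_image_in_modular_quotient :
    ∃ γ : ℝ → ℍ,
      (∀ s t : ℝ, dist (γ s) (γ t) = |s - t|) ∧
      Dense (Set.range fun t : ℝ =>
        (Quotient.mk (MulAction.orbitRel (SpecialLinearGroup (Fin 2) ℤ) ℍ) (γ t) :
          Quotient (MulAction.orbitRel (SpecialLinearGroup (Fin 2) ℤ) ℍ))) := by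
  let S : Set ℍ → Set ℝ := fun B =>
    ⋃ (t : ℝ) (g : SpecialLinearGroup (Fin 2) ℤ), {x | g • vertLine x t ∈ B}
  have hb := TopologicalSpace.isBasis_countableBasis ℍ
  have hd : Dense (⋂ B ∈ TopologicalSpace.countableBasis ℍ, S B) := by
    apply dense_biInter_of_isOpen
    · intro B hB
      refine isOpen_iUnion fun t => isOpen_iUnion fun g => ?_
      exact (hb.isOpen hB).preimage ((continuous_modular_smul g).comp (continuous_vertLine t))
    · exact TopologicalSpace.countable_countableBasis ℍ
    · intro B hB
      obtain ⟨z, hz⟩ := TopologicalSpace.nonempty_of_mem_countableBasis hB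
      rw [Metric.dense_iff]
      intro x ε hε
      obtain ⟨g, hg⟩ := exists_smul_re_near z x ε hε
      refine ⟨(g • z).re, ?_, ?_⟩
      · rw [Metric.mem_ball, Real.dist_eq]
        exact hg
      · simp only [S, mem_iUnion, mem_ofPred_eq]
        refine ⟨Real.log (g • z).im, g⁻¹, ?_⟩
        rw [vertLine_re_log_im, inv_smul_smul]
        exact hz
  obtain ⟨x, hx⟩ := hd.nonempty
  refine ⟨vertLine x, dist_vertLine x, ?_⟩
  rw [dense_iff_inter_open]
  rintro V hV ⟨p, hp⟩
  obtain ⟨z, rfl⟩ := Quotient.exists_rep p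
  have hV' := hV.preimage (continuous_quotient_mk'
    (s := MulAction.orbitRel (SpecialLinearGroup (Fin 2) ℤ) ℍ))
  obtain ⟨B, hB, -, hBV⟩ := hb.exists_subset_of_mem_open (show z ∈ _ from hp) hV'
  have hxB := mem_iInter₂.mp hx B hB
  simp only [S, mem_iUnion, mem_ofPred_eq] at hxB
  obtain ⟨t, g, hg⟩ := hxB
  refine ⟨_, ?_, ⟨t, rfl⟩⟩
  have h1 := hBV hg
  have h2 : (Quotient.mk (MulAction.orbitRel (SpecialLinearGroup (Fin 2) ℤ) ℍ)
      (g • vertLine x t)) = Quotient.mk _ (vertLine x t) :=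
    Quotient.sound (s := MulAction.orbitRel (SpecialLinearGroup (Fin 2) ℤ) ℍ) ⟨g, rfl⟩
  beta_reduce
  rw [← h2]
  exact h1
end

section
/- Let a = t₀ < t₁ < ⋯ < tₙ = b be a partition and let F : ℝ → ℝ be continuous on [a,b], nonnegative on [a,b], with F(a) = F(b) = 0, and convex on each subinterval [tᵢ, tᵢ₊₁]. Suppose that at each interior partition point tᵢ (0 < i < n) the one-sided derivatives exist: F has derivative dᵢ⁻ within (−∞, tᵢ] at tᵢ and derivative dᵢ⁺ within [tᵢ, ∞) at tᵢ, and set A = Σ_{0<i<n} max(0, dᵢ⁻ − dᵢ⁺) (the total downward jump of the derivative). Then every one-sided derivative of F is bounded by A in absolute value: for every s ∈ (a,b) and every d such that F has derivative d at s within [s,∞) or within (−∞,s], one has |d| ≤ A. -/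
open Set Finset

lemma glue_convex {G : ℝ → ℝ} {a c b m : ℝ} (h1 : ConvexOn ℝ (Set.Icc a c) G)
    (h2 : ConvexOn ℝ (Set.Icc c b) G)
    (hl : ∀ x ∈ Set.Icc a c, G c + m * (x - c) ≤ G x)
    (hr : ∀ x ∈ Set.Icc c b, G c + m * (x - c) ≤ G x) :
    ConvexOn ℝ (Set.Icc a b) G := by
  apply convexOn_of_slope_mono_adjacent (convex_Icc a b)
  intro x y z hx hz hxy hyz
  rcases le_or_gt z c with hzc | hzc
  · exact h1.slope_mono_adjacent ⟨hx.1, by linarith⟩ ⟨by linarith [hx.1], hzc⟩ hxy hyz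
  rcases le_or_gt c x with hcx | hcx
  · exact h2.slope_mono_adjacent ⟨hcx, hx.2⟩ ⟨hzc.le, hz.2⟩ hxy hyz
  have hzm := hr z ⟨hzc.le, hz.2⟩
  have hxm := hl x ⟨hx.1, hcx.le⟩
  rcases lt_trichotomy y c with hyc | hyc | hyc
  · have k1 := h1.slope_mono_adjacent (x := x) (y := y) (z := c) ⟨hx.1, hcx.le⟩
      ⟨by linarith [hx.1], le_rfl⟩ hxy hyc
    refine k1.trans ?_
    have hym := hl y ⟨by linarith [hx.1], hyc.le⟩
    have k2 : (G c - G y) / (c - y) ≤ m := by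
      rw [div_le_iff₀ (by linarith)]; linarith
    have k3 : G c - G y = (G c - G y) / (c - y) * (c - y) := by
      rw [div_mul_cancel₀]; linarith
    rw [le_div_iff₀ (by linarith)]
    have := mul_le_mul_of_nonneg_right k2 (show 0 ≤ z - c by linarith)
    linarith
  · subst hyc
    have e1 : (G y - G x) / (y - x) ≤ m := by
      rw [div_le_iff₀ (by linarith)]; linarith
    refine e1.trans ?_
    rw [le_div_iff₀ (by linarith)]; linarith
  · have k1 := h2.slope_mono_adjacent (x := c) (y := y) (z := z) ⟨le_rfl, by linarith [hz.2]⟩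
      ⟨hzc.le, hz.2⟩ hyc hyz
    refine le_trans ?_ k1
    have hym := hr y ⟨hyc.le, by linarith [hz.2]⟩
    have k2 : m ≤ (G y - G c) / (y - c) := by
      rw [le_div_iff₀ (by linarith)]; linarith
    have k3 : G y - G c = (G y - G c) / (y - c) * (y - c) := by
      rw [div_mul_cancel₀]; linarith
    rw [div_le_iff₀ (by linarith)]
    have := mul_le_mul_of_nonneg_right k2 (show 0 ≤ c - x by linarith)
    linarith

/-- The piecewise linear correction. -/
noncomputable def corr (J t : ℕ → ℝ) (k : ℕ) (x : ℝ) : ℝ :=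
  ∑ i ∈ Finset.Ioo 0 k, J i * max 0 (x - t i)

lemma corr_succ (J t : ℕ → ℝ) (k : ℕ) (hk : 0 < k) (x : ℝ) :
    corr J t (k + 1) x = corr J t k x + J k * max 0 (x - t k) := by
  have : Finset.Ioo 0 (k + 1) = insert k (Finset.Ioo 0 k) := by
    ext i; simp only [Finset.mem_Ioo, Finset.mem_insert]; omega
  unfold corr
  rw [this, Finset.sum_insert (by simp)]
  ring

lemma corr_linear (J t : ℕ → ℝ) (k : ℕ) (c x : ℝ) (hc : ∀ i < k, t i ≤ c) (hx : c ≤ x) :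
    corr J t k x = corr J t k c + (∑ i ∈ Finset.Ioo 0 k, J i) * (x - c) := by
  unfold corr
  rw [Finset.sum_mul, ← Finset.sum_add_distrib]
  refine Finset.sum_congr rfl fun i hi => ?_
  have := hc i (Finset.mem_Ioo.1 hi).2
  rw [max_eq_right (by linarith), max_eq_right (by linarith)]
  ring

lemma corr_deriv (J t : ℕ → ℝ) (k : ℕ) (c : ℝ) (hc : ∀ i < k, t i < c) :
    HasDerivAt (corr J t k) (∑ i ∈ Finset.Ioo 0 k, J i) c := by
  unfold corr
  refine HasDerivAt.fun_sum fun i hi => ?_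
  have := hc i (Finset.mem_Ioo.1 hi).2
  have h : HasDerivAt (fun x => J i * (x - t i)) (J i) c := by
    simpa using ((hasDerivAt_id c).sub_const (t i)).const_mul (J i)
  refine h.congr_of_eventuallyEq ?_
  filter_upwards [lt_mem_nhds this] with x hx
  rw [max_eq_right (by linarith)]

lemma corr_mono (J t : ℕ → ℝ) (hJ : ∀ i, 0 ≤ J i) (k : ℕ) {x y : ℝ} (h : x ≤ y) :
    corr J t k x ≤ corr J t k y := by
  unfold corr
  refine Finset.sum_le_sum fun i _ => mul_le_mul_of_nonneg_left ?_ (hJ i)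
  exact max_le_max le_rfl (by linarith)

lemma corr_lip (J t : ℕ → ℝ) (hJ : ∀ i, 0 ≤ J i) (k : ℕ) {x y : ℝ} (h : x ≤ y) :
    corr J t k y ≤ corr J t k x + (∑ i ∈ Finset.Ioo 0 k, J i) * (y - x) := by
  unfold corr
  rw [Finset.sum_mul, ← Finset.sum_add_distrib]
  refine Finset.sum_le_sum fun i _ => ?_
  rw [← mul_add]
  refine mul_le_mul_of_nonneg_left ?_ (hJ i)
  apply max_le
  · have := le_max_left 0 (x - t i); linarith
  · have := le_max_right 0 (x - t i); linarith

lemma ramp_convex (j u : ℝ) (hj : 0 ≤ j) (s : Set ℝ) (hs : Convex ℝ s) :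
    ConvexOn ℝ s (fun x => j * max 0 (x - u)) := by
  have h : ConvexOn ℝ s (fun x : ℝ => max 0 (x - u)) :=
    (convexOn_const 0 hs).sup ((convexOn_id hs).sub (concaveOn_const u hs))
  exact h.smul hj

lemma corr_convex (J t : ℕ → ℝ) (hJ : ∀ i, 0 ≤ J i) (k : ℕ) (s : Set ℝ) (hs : Convex ℝ s) :
    ConvexOn ℝ s (corr J t k) := by
  unfold corr
  induction Finset.Ioo 0 k using Finset.induction_on with
  | empty => simpa using convexOn_const (0 : ℝ) hs
  | insert i S hi ih =>
    simp only [Finset.sum_insert hi]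
    exact (ramp_convex (J i) (t i) (hJ i) s hs).add ih

/-- Abstract form of the chord-distance derivative bound of Section 3: a continuous
nonnegative function on `[a,b]`, vanishing at the endpoints, convex on each
subinterval of a partition, has all of its one-sided derivatives bounded in absolute
value by the total downward jump `A` of its derivative at the interior partition
points. -/
theorem abs_one_sided_deriv_le_total_downward_jump
    (a b : ℝ) (n : ℕ) (t : ℕ → ℝ)
    (ht0 : t 0 = a) (htn : t n = b)
    (htmono : ∀ i < n, t i < t (i + 1))
    (F : ℝ → ℝ)
    (hcont : ContinuousOn F (Icc a b))
    (hnonneg : ∀ x ∈ Icc a b, 0 ≤ F x)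
    (hFa : F a = 0) (hFb : F b = 0)
    (hconv : ∀ i < n, ConvexOn ℝ (Icc (t i) (t (i + 1))) F)
    (dminus dplus : ℕ → ℝ)
    (hdminus : ∀ i, 0 < i → i < n → HasDerivWithinAt F (dminus i) (Iic (t i)) (t i))
    (hdplus : ∀ i, 0 < i → i < n → HasDerivWithinAt F (dplus i) (Ici (t i)) (t i))
    (A : ℝ) (hA : A = ∑ i ∈ Finset.Ioo 0 n, max 0 (dminus i - dplus i)) :
    ∀ s ∈ Ioo a b, ∀ d : ℝ,
      (HasDerivWithinAt F d (Ici s) s ∨ HasDerivWithinAt F d (Iic s) s) →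
      |d| ≤ A := by
  intro s hs d hd
  set J : ℕ → ℝ := fun i => max 0 (dminus i - dplus i) with hJdef
  have hJ : ∀ i, 0 ≤ J i := fun i => le_max_left _ _
  have hAJ : A = ∑ i ∈ Finset.Ioo 0 n, J i := hA
  have hlt : ∀ k ≤ n, ∀ i < k, t i < t k := by
    intro k
    induction k with
    | zero => intro _ i hi; omega
    | succ k ih =>
      intro hk i hi
      have h1 := htmono k (by omega)
      rcases Nat.lt_succ_iff_lt_or_eq.1 hi with h | h
      · exact (ih (by omega) i h).trans h1
      · rw [h]; exact h1
  have hn : 1 ≤ n := by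
    rcases Nat.eq_zero_or_pos n with h | h
    · subst h
      have := hs.1.trans hs.2
      rw [← ht0, ← htn] at this
      exact absurd this (lt_irrefl _)
    · exact h
  have key : ∀ k, 1 ≤ k → k ≤ n →
      ConvexOn ℝ (Set.Icc (t 0) (t k)) (fun x => F x + corr J t k x) := by
    intro k hk
    induction k, hk using Nat.le_induction with
    | base =>
      intro h1
      exact (hconv 0 (by omega)).add (corr_convex J t hJ 1 _ (convex_Icc _ _))
    | succ k hk ih =>
      intro hkn
      have ih := ih (by omega)
      have h0k := hlt k (by omega) 0 (by omega)
      have hkk := htmono k (by omega)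
      have heq : ∀ x ≤ t k, corr J t (k + 1) x = corr J t k x := by
        intro x hx
        rw [corr_succ J t k (by omega), max_eq_left (by linarith)]
        ring
      have hder : HasDerivWithinAt (fun x => F x + corr J t k x)
          (dminus k + ∑ i ∈ Finset.Ioo 0 k, J i) (Set.Iio (t k)) (t k) :=
        ((hdminus k (by omega) (by omega)).mono Set.Iio_subset_Iic_self).add
          (corr_deriv J t k (t k) (hlt k (by omega))).hasDerivWithinAt
      refine glue_convex (c := t k) (m := dminus k + ∑ i ∈ Finset.Ioo 0 k, J i) ?_ ?_ ?_ ?_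
      · refine ih.congr fun x hx => ?_
        simp only [heq x hx.2]
      · exact (hconv k (by omega)).add (corr_convex J t hJ _ _ (convex_Icc _ _))
      · intro x hx
        rw [heq x hx.2, heq _ le_rfl]
        rcases hx.2.eq_or_lt with h | h
        · rw [h]; simp
        · have := ih.slope_le_of_hasDerivWithinAt_Iio hx ⟨h0k.le, le_rfl⟩ h hder
          rw [slope_def_field, div_le_iff₀ (by linarith)] at this
          linarith
      · intro x hx
        rw [heq _ le_rfl, corr_succ J t k (by omega), max_eq_right (by linarith [hx.1]),
          corr_linear J t k (t k) x (fun i hi => (hlt k (by omega) i hi).le) hx.1]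
        rcases hx.1.eq_or_lt with h | h
        · rw [← h]; simp
        · have := (hconv k (by omega)).le_slope_of_hasDerivWithinAt_Ioi ⟨le_rfl, hkk.le⟩ hx h
            ((hdplus k (by omega) (by omega)).mono Set.Ioi_subset_Ici_self)
          rw [slope_def_field, le_div_iff₀ (by linarith)] at this
          have h2 : dminus k - dplus k ≤ J k := le_max_right _ _
          have := mul_le_mul_of_nonneg_right h2 (show 0 ≤ x - t k by linarith)
          linarith
  have hG := key n hn le_rfl
  rw [ht0, htn] at hG
  have lip : ∀ x y, a < x → x < y → y < b → |F y - F x| ≤ A * (y - x) := by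
    intro x y hax hxy hyb
    have hm : ∀ {u v : ℝ}, u ≤ v → corr J t n u ≤ corr J t n v := fun h => corr_mono J t hJ n h
    have hl : ∀ {u v : ℝ}, u ≤ v → corr J t n v ≤ corr J t n u + A * (v - u) := by
      intro u v h
      rw [hAJ]; exact corr_lip J t hJ n h
    have s1 := hG.slope_mono_adjacent (x := a) (y := x) (z := y) ⟨le_rfl, by linarith⟩
      ⟨by linarith, hyb.le⟩ hax hxy
    have s2 := hG.slope_mono_adjacent (x := x) (y := y) (z := b) ⟨hax.le, by linarith⟩
      ⟨by linarith, le_rfl⟩ hxy hyb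
    have hFx := hnonneg x ⟨hax.le, by linarith⟩
    have hFy := hnonneg y ⟨by linarith, hyb.le⟩
    have p1 := (div_nonneg (by linarith [hm hax.le]) (by linarith)).trans s1
    have p2 := s2.trans ((div_le_iff₀ (sub_pos.2 hyb)).2 (show _ ≤ A * (b - y) by linarith [hl hyb.le]))
    rw [le_div_iff₀ (by linarith)] at p1
    rw [div_le_iff₀ (by linarith)] at p2
    have := hm hxy.le
    have := hl hxy.le
    rw [abs_le]
    constructor <;> linarith
  have hslope : ∀ x ∈ Set.Ioo a b, x ≠ s → |slope F s x| ≤ A := by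
    intro x hx hxs
    rcases lt_or_gt_of_ne hxs with h | h
    · rw [slope_comm, slope_def_field, abs_div, abs_of_pos (sub_pos.2 h),
        div_le_iff₀ (sub_pos.2 h)]
      exact lip x s hx.1 h hs.2
    · rw [slope_def_field, abs_div, abs_of_pos (sub_pos.2 h), div_le_iff₀ (sub_pos.2 h)]
      exact lip s x hs.1 h hx.2
  have hnb : ∀ S : Set ℝ, ∀ᶠ x in nhdsWithin s (S \ {s}), |slope F s x| ≤ A := by
    intro S
    filter_upwards [mem_nhdsWithin_of_mem_nhds (Ioo_mem_nhds hs.1 hs.2), self_mem_nhdsWithin]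
      with x hx hx2
    exact hslope x hx hx2.2
  rcases hd with hd | hd
  · have h := hasDerivWithinAt_iff_tendsto_slope.1 hd
    have hb := hnb (Set.Ici s)
    rw [Set.Ici_sdiff_left] at h hb
    exact le_of_tendsto h.abs hb
  · have h := hasDerivWithinAt_iff_tendsto_slope.1 hd
    have hb := hnb (Set.Iic s)
    rw [Set.Iic_sdiff_right] at h hb
    exact le_of_tendsto h.abs hb
end

section
/- The number of distinct lengths of closed geodesics on the modular surface grows exponentially: for every real T ≥ 4 there exists a finite set S of real numbers with cardinality at least exp(T/4), such that every L ∈ S satisfies 0 < L ≤ T and there exist a unit-speed geodesic line γ : ℝ → ℍ and an element g ∈ SL(2,ℤ) with g·γ(t) = γ(t + L) for all t ∈ ℝ. -/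
open UpperHalfPlane Set Matrix

/-- The axis: for `a > 0` with `2 cosh a = n`, the matrix `!![n, -1; 1, 0]` translates a geodesic
by `2 * a`. -/
theorem exists_axis_aux (n : ℤ) (a : ℝ) (ha : 0 < a) (hn : 2 * Real.cosh a = n) :
    ∃ γ : ℝ → ℍ, ∃ g : SpecialLinearGroup (Fin 2) ℤ,
      (∀ s t : ℝ, dist (γ s) (γ t) = |s - t|) ∧ ∀ t : ℝ, g • γ t = γ (t + 2 * a) := by
  have hlm : 0 < Real.exp a - Real.exp (-a) := by
    have : Real.exp (-a) < Real.exp a := Real.exp_lt_exp.2 (by linarith)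
    linarith
  obtain ⟨s, hs0, hs⟩ : ∃ s : ℝ, 0 < s ∧ s ^ 2 * (Real.exp a - Real.exp (-a)) = 1 := by
    refine ⟨(√(Real.exp a - Real.exp (-a)))⁻¹, by positivity, ?_⟩
    rw [inv_pow, Real.sq_sqrt hlm.le, inv_mul_cancel₀ hlm.ne']
  let H : SpecialLinearGroup (Fin 2) ℝ :=
    ⟨!![Real.exp a * s, Real.exp (-a) * s; s, s], by rw [Matrix.det_fin_two_of]; linarith⟩
  let v : ℝ → ℍ := fun y => UpperHalfPlane.mk ⟨0, Real.exp y⟩ (Real.exp_pos y)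
  have hv : Isometry v := isometry_vertical_line 0
  have hH : Isometry (fun y => H • v y) := (isometry_smul ℍ H).comp hv
  let G : SpecialLinearGroup (Fin 2) ℤ := ⟨!![n, -1; 1, 0], by simp [Matrix.det_fin_two_of]⟩
  have hG : ∀ z : ℍ, ((G • z : ℍ) : ℂ) = ((n : ℂ) * z + -1) / z := by
    intro z
    rw [coe_specialLinearGroup_apply]
    simp [G]
  refine ⟨fun y => H • v y, G, ?_, ?_⟩
  · intro x t
    rw [hH.dist_eq, Real.dist_eq]
  · intro t
    have hform : ∀ y, ((H • v y : ℍ) : ℂ) =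
        (Real.exp a * (Real.exp y * Complex.I) + Real.exp (-a)) / (Real.exp y * Complex.I + 1) := by
      intro y
      have h1 : ((Real.exp y : ℝ) : ℂ) * Complex.I + 1 ≠ 0 := by
        intro h
        have := congrArg Complex.re h
        simp [-Complex.ofReal_exp] at this
      have h2 : (s : ℂ) ≠ 0 := by exact_mod_cast hs0.ne'
      have h3 : ((v y : ℍ) : ℂ) = (Real.exp y : ℝ) * Complex.I := by
        apply Complex.ext <;> simp [v, -Complex.ofReal_exp]
      rw [coe_specialLinearGroup_apply, h3]
      simp only [H, Matrix.of_apply, Matrix.cons_val', Matrix.cons_val_zero, Matrix.cons_val_one,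
        Matrix.cons_val_fin_one, Algebra.algebraMap_self, RingHom.id_apply, Complex.ofReal_mul]
      have h4 : (s : ℂ) * ((Real.exp y : ℝ) * Complex.I) + s ≠ 0 := by
        have : (s : ℂ) * ((Real.exp y : ℝ) * Complex.I) + s
          = s * (((Real.exp y : ℝ) : ℂ) * Complex.I + 1) := by ring
        rw [this]; exact mul_ne_zero h2 h1
      rw [div_eq_div_iff h4 h1]
      ring
    apply UpperHalfPlane.ext
    have hne : ((H • v t : ℍ) : ℂ) ≠ 0 := UpperHalfPlane.ne_zero _
    rw [hform] at hne
    rw [hG, hform, hform]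
    have hd : ∀ y, ((Real.exp y : ℝ) : ℂ) * Complex.I + 1 ≠ 0 := by
      intro y h
      have := congrArg Complex.re h
      simp [-Complex.ofReal_exp] at this
    have hd1 := hd t
    have hd2 := hd (t + 2 * a)
    have hnC : (n : ℂ) = (Real.exp a : ℝ) + (Real.exp (-a) : ℝ) := by
      have : (n : ℝ) = Real.exp a + Real.exp (-a) := by rw [← hn, Real.cosh_eq]; ring
      exact_mod_cast this
    have he : ((Real.exp a : ℝ) : ℂ) * (Real.exp (-a) : ℝ) = 1 := by
      rw [← Complex.ofReal_mul, ← Real.exp_add]; simp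
    have hE : ((Real.exp (t + 2 * a) : ℝ) : ℂ) * Complex.I =
        (Real.exp t : ℝ) * Complex.I * (Real.exp a : ℝ) ^ 2 := by
      rw [Real.exp_add, two_mul, Real.exp_add]; push_cast; ring
    rw [hE] at hd2 ⊢
    have hnum := (div_ne_zero_iff.1 hne).1
    generalize ((Real.exp a : ℝ) : ℂ) = l at *
    generalize ((Real.exp (-a) : ℝ) : ℂ) = m at *
    generalize ((Real.exp t : ℝ) : ℂ) * Complex.I = w at *
    have hk : ((n : ℂ) * ((l * w + m) / (w + 1)) + -1) / ((l * w + m) / (w + 1)) =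
        (l ^ 2 * w + m ^ 2) / (l * w + m) := by
      rw [hnC]
      field_simp
      linear_combination (w + 1) * he
    rw [hk, div_eq_div_iff hnum hd2]
    linear_combination (l * m * w - l ^ 2 * w) * he

theorem modular_surface_closed_geodesic_lengths_grow_exponentially :
    ∀ T : ℝ, 4 ≤ T →
      ∃ S : Finset ℝ, Real.exp (T / 4) ≤ (S.card : ℝ) ∧
        ∀ L ∈ S, 0 < L ∧ L ≤ T ∧
          ∃ γ : ℝ → ℍ, ∃ g : SpecialLinearGroup (Fin 2) ℤ,
            (∀ s t : ℝ, dist (γ s) (γ t) = |s - t|) ∧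
            ∀ t : ℝ, g • γ t = γ (t + L) := by
  intro T hT
  set N : ℕ := ⌊2 * Real.cosh (T / 2)⌋₊ with hN
  refine ⟨(Finset.Icc 3 N).image (fun n : ℕ => 2 * Real.arcosh ((n : ℝ) / 2)), ?_, ?_⟩
  · rw [Finset.card_image_of_injOn, Nat.card_Icc]
    · have h1 : 2 * Real.cosh (T / 2) < N + 1 := Nat.lt_floor_add_one _
      have h2 : (N : ℝ) + 1 - 3 ≤ ((N + 1 - 3 : ℕ) : ℝ) := by
        rw [sub_le_iff_le_add]
        exact_mod_cast (by omega : N + 1 ≤ N + 1 - 3 + 3)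
      have h3 : 2 * Real.cosh (T / 2) = Real.exp (T / 2) + Real.exp (-(T / 2)) := by
        rw [Real.cosh_eq]; ring
      have h4 : Real.exp (T / 2) = Real.exp (T / 4) ^ 2 := by
        rw [← Real.exp_nat_mul]; congr 1; push_cast; ring
      have h5 : 2.7 < Real.exp (T / 4) := by
        have := Real.exp_one_gt_d9
        have h : Real.exp 1 ≤ Real.exp (T / 4) := Real.exp_le_exp.2 (by linarith)
        norm_num at this ⊢
        linarith
      have h6 := Real.exp_pos (-(T / 2))
      norm_num at h5
      nlinarith
    · intro x hx y hy hxy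
      simp only [Finset.coe_Icc, Set.mem_Icc] at hx hy
      have hx3 : (3 : ℝ) ≤ x := by exact_mod_cast hx.1
      have hy3 : (3 : ℝ) ≤ y := by exact_mod_cast hy.1
      have h : Real.arcosh ((x : ℝ) / 2) = Real.arcosh ((y : ℝ) / 2) := by
        simpa using hxy
      have := Real.arcosh_injOn (show (x : ℝ) / 2 ∈ Set.Ici 1 by simp; linarith)
        (show (y : ℝ) / 2 ∈ Set.Ici 1 by simp; linarith) h
      have h' : (x : ℝ) = y := by linarith
      exact_mod_cast h'
  · intro L hL
    obtain ⟨n, hn, rfl⟩ := Finset.mem_image.1 hL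
    rw [Finset.mem_Icc] at hn
    have hn3 : (3 : ℝ) ≤ n := by exact_mod_cast hn.1
    have hpos : 0 < Real.arcosh ((n : ℝ) / 2) := Real.arcosh_pos (by linarith)
    refine ⟨by linarith, ?_, exists_axis_aux n _ hpos ?_⟩
    · have h1 : (n : ℝ) ≤ 2 * Real.cosh (T / 2) :=
        (Nat.le_floor_iff (by positivity)).1 hn.2
      have h2 := (Real.arcosh_le_arcosh (x := (n : ℝ) / 2) (y := Real.cosh (T / 2))
        (by linarith) (Real.cosh_pos _)).2 (by linarith)
      rw [Real.arcosh_cosh (by linarith)] at h2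
      linarith
    · rw [Real.cosh_arcosh (by linarith)]
      push_cast; ring
end
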